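/- arXiv:1904.12801 — 4 statements merged into one kernel-verified Lean document; each statement's English description precedes it below -/
import Mathlib

section
/- (Derived subgroup lemma for groups.) Let G be a finite group and f an automorphism of G. If the subgroup [G,f] generated by {g * (f g)⁻¹ : g ∈ G} equals all of G, then every fixed point of f lies in the commutator subgroup: for all a ∈ G, f a = a implies a ∈ γ₁(G). -/
theorem stmt2 (G : Type*) [Group G] [Finite G] (f : G ≃* G)
    (hgen : Subgroup.closure {x : G | ∃ g : G, x = g * (f g)⁻¹} = ⊤) :
    ∀ a : G, f a = a → a ∈ commutator G := by
  intro a ha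
  let φ : Abelianization G →* Abelianization G :=
    MonoidHom.id _ / Abelianization.map f.toMonoidHom
  have hφ : ∀ g : G, φ (Abelianization.of g) = Abelianization.of (g * (f g)⁻¹) := by
    intro g
    simp [φ, div_eq_mul_inv]
  have hle : (⊤ : Subgroup G) ≤ φ.range.comap Abelianization.of := by
    rw [← hgen, Subgroup.closure_le]
    rintro x ⟨g, rfl⟩
    exact ⟨Abelianization.of g, hφ g⟩
  have hsurj : Function.Surjective φ := by
    intro y
    obtain ⟨g, rfl⟩ := QuotientGroup.mk_surjective y
    exact hle (Subgroup.mem_top g)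
  haveI : Finite (Abelianization G) :=
    Finite.of_surjective _ (QuotientGroup.mk_surjective (s := commutator G))
  have hinj : Function.Injective φ := Finite.injective_iff_surjective.mpr hsurj
  have h1 : Abelianization.of a = 1 := by
    apply hinj
    rw [hφ, ha]
    simp
  exact (QuotientGroup.eq_one_iff a).mp h1
end

section
/- Let Q be a finite connected quandle. If Dis(Q) is nilpotent of class at most 2 (i.e. its commutator subgroup is contained in its center), then Q is principal: for every a ∈ Q, the only element h ∈ Dis(Q) with h a = a is the identity. -/
open Quandles

/-- Left multiplication by `a` as a permutation of the quandle. -/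
def QL {Q : Type*} [Quandle Q] (a : Q) : Equiv.Perm Q := Rack.act' a

/-- The displacement group of a quandle: the subgroup of `Equiv.Perm Q`
generated by `{L a * (L b)⁻¹ : a, b ∈ Q}`. -/
def Dis (Q : Type*) [Quandle Q] : Subgroup (Equiv.Perm Q) :=
  Subgroup.closure {g : Equiv.Perm Q | ∃ a b : Q, g = QL a * (QL b)⁻¹}


theorem QL_act {Q : Type*} [Quandle Q] (a x : Q) :
    QL (QL a x) = QL a * QL x * (QL a)⁻¹ := Rack.ad_conj a x

theorem QL_act_inv {Q : Type*} [Quandle Q] (a x : Q) :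
    QL ((QL a)⁻¹ x) = (QL a)⁻¹ * QL x * QL a := by
  have h := QL_act a ((QL a)⁻¹ x)
  rw [← Equiv.Perm.mul_apply, mul_inv_cancel, Equiv.Perm.one_apply] at h
  rw [h]; group

theorem QL_dis {Q : Type*} [Quandle Q] (g : Equiv.Perm Q) (hg : g ∈ Dis Q) :
    ∀ x : Q, QL (g x) = g * QL x * g⁻¹ := by
  unfold Dis at hg
  induction hg using Subgroup.closure_induction with
  | mem g hg =>
    obtain ⟨a, b, rfl⟩ := hg
    intro x
    rw [Equiv.Perm.mul_apply, QL_act, QL_act_inv]; group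
  | one => intro x; simp
  | mul g k _ _ hg hk =>
    intro x
    rw [Equiv.Perm.mul_apply, hg, hk]; group
  | inv g _ hg =>
    intro x
    have h := hg (g⁻¹ x)
    rw [← Equiv.Perm.mul_apply, mul_inv_cancel, Equiv.Perm.one_apply] at h
    rw [h]; group

theorem gen_mem {Q : Type*} [Quandle Q] (a b : Q) : QL a * (QL b)⁻¹ ∈ Dis Q :=
  Subgroup.subset_closure ⟨a, b, rfl⟩

theorem conj_mem_dis {Q : Type*} [Quandle Q] (a : Q) (g : Equiv.Perm Q) (hg : g ∈ Dis Q) :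
    QL a * g * (QL a)⁻¹ ∈ Dis Q := by
  have h := QL_dis g⁻¹ (inv_mem hg) a
  have e : QL a * g * (QL a)⁻¹ = g * (QL (g⁻¹ a) * (QL a)⁻¹) := by rw [h]; group
  rw [e]
  exact mul_mem hg (gen_mem _ _)

/-- Conjugation by `L a` on the displacement group. -/
def disConj {Q : Type*} [Quandle Q] (a : Q) : ↥(Dis Q) →* ↥(Dis Q) where
  toFun g := ⟨QL a * g * (QL a)⁻¹, conj_mem_dis a g g.2⟩
  map_one' := by ext1; simp
  map_mul' g h := by ext1; simp

theorem stmt4 (Q : Type*) [Quandle Q] [Finite Q]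
    (hconn : ∀ x y : Q, ∃ g ∈ Dis Q, g x = y)
    (hnil : commutator ↥(Dis Q) ≤ Subgroup.center ↥(Dis Q)) :
    ∀ (a : Q) (h : Equiv.Perm Q), h ∈ Dis Q → h a = a → h = 1 := by
  intro a h hh ha
  have : Finite (Equiv.Perm Q) := inferInstance
  let A := Abelianization ↥(Dis Q)
  have : Finite A := Quotient.finite _
  let ψ : A →* A := MonoidHom.id A / Abelianization.map (disConj a)
  have hψ : ∀ g : ↥(Dis Q), ψ (Abelianization.of g)
      = Abelianization.of (g * (disConj a g)⁻¹) := by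
    intro g
    simp [ψ, div_eq_mul_inv]
    rfl
  have hbase : ∀ x : Q, Abelianization.of (⟨_, gen_mem x a⟩ : ↥(Dis Q)) ∈ ψ.range := by
    intro x
    obtain ⟨g, hg, rfl⟩ := hconn a x
    refine ⟨Abelianization.of ⟨g, hg⟩, ?_⟩
    rw [hψ]
    congr 1
    ext1
    simp only [disConj, MonoidHom.coe_mk, OneHom.coe_mk, Subgroup.coe_mul, Subgroup.coe_inv]
    rw [QL_dis g hg]; group
  have hall : ∀ (g : Equiv.Perm Q) (hg : g ∈ Dis Q),
      Abelianization.of (⟨g, hg⟩ : ↥(Dis Q)) ∈ ψ.range := by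
    intro g hg
    induction hg using Subgroup.closure_induction with
    | mem g hg =>
      obtain ⟨x, y, rfl⟩ := hg
      have := mul_mem (hbase x) (inv_mem (hbase y))
      rw [← map_inv, ← map_mul] at this
      convert this using 2
      ext1
      simp only [Subgroup.coe_mul, Subgroup.coe_inv]
      group
    | one => exact one_mem ψ.range
    | mul g k hg hk ig ik => exact mul_mem ig ik
    | inv g hg ig => exact inv_mem ig
  have hsurj : Function.Surjective ψ := by
    intro y
    obtain ⟨g, rfl⟩ := QuotientGroup.mk_surjective y
    exact hall g.1 g.2
  have hinj : Function.Injective ψ := Finite.injective_iff_surjective.mpr hsurj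
  have hfix : disConj a ⟨h, hh⟩ = ⟨h, hh⟩ := by
    ext1
    have e := QL_dis h hh a
    rw [ha] at e
    change QL a * h * (QL a)⁻¹ = h
    rw [mul_inv_eq_iff_eq_mul]
    nth_rewrite 1 [e]
    group
  have h1 : Abelianization.of (⟨h, hh⟩ : ↥(Dis Q)) = 1 := by
    apply hinj
    rw [hψ, hfix]; simp
  have hz : (⟨h, hh⟩ : ↥(Dis Q)) ∈ Subgroup.center ↥(Dis Q) := by
    apply hnil
    rw [← Abelianization.ker_of]
    exact h1
  ext x
  obtain ⟨g, hg, rfl⟩ := hconn a x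
  have := congrArg Subtype.val (Subgroup.mem_center_iff.mp hz ⟨g, hg⟩)
  have := congrArg (fun p : Equiv.Perm Q => p a) this
  simp only [Subgroup.coe_mul, Equiv.Perm.mul_apply, ha] at this
  simpa using this.symm
end

section
/- Let p be a prime, n ≥ 1, and let Q be a connected quandle with Nat.card Q = p^n. Then the cardinality of the center of the group Dis(Q) is not equal to p^(n-1). -/
open Quandles

abbrev FF := AlgebraicClosure ℚ

lemma trace_group {H : Type*} [Group H] [Fintype H] [DecidableEq H] (g : H) :
    LinearMap.trace FF (MonoidAlgebra FF H) (LinearMap.mulLeft FF (MonoidAlgebra.of FF H g)) =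
      if g = 1 then (Fintype.card H : FF) else 0 := by
  classical
  rw [LinearMap.trace_eq_matrix_trace FF (MonoidAlgebra.basis H FF), Matrix.trace]
  simp only [Matrix.diag, LinearMap.toMatrix_apply]
  have : ∀ x : H, ((MonoidAlgebra.basis H FF).repr ((LinearMap.mulLeft FF (MonoidAlgebra.of FF H g))
      ((MonoidAlgebra.basis H FF) x))) x = if g = 1 then 1 else 0 := by
    intro x
    simp [MonoidAlgebra.basis, MonoidAlgebra.single_mul_single, Finsupp.single_apply]
  rw [Finset.sum_congr rfl fun x _ => this x]
  simp

lemma trace_mat {n : ℕ} (d : Fin n → ℕ) (x : Π i, Matrix (Fin (d i)) (Fin (d i)) FF) :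
    LinearMap.trace FF (Π i, Matrix (Fin (d i)) (Fin (d i)) FF) (LinearMap.mulLeft FF x) =
      ∑ i, (d i : FF) * (x i).trace := by
  classical
  rw [LinearMap.trace_eq_matrix_trace FF
    (Pi.basis (fun i => Matrix.stdBasis FF (Fin (d i)) (Fin (d i)))), Matrix.trace]
  simp only [Matrix.diag, LinearMap.toMatrix_apply]
  rw [Fintype.sum_sigma]
  refine Finset.sum_congr rfl fun i _ => ?_
  rw [Fintype.sum_prod_type, Matrix.trace, Finset.mul_sum]
  refine Finset.sum_congr rfl fun a _ => ?_
  have : ∀ b : Fin (d i), ((Pi.basis fun i => Matrix.stdBasis FF (Fin (d i)) (Fin (d i))).repr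
      ((LinearMap.mulLeft FF x) ((Pi.basis fun i => Matrix.stdBasis FF (Fin (d i)) (Fin (d i)))
        ⟨i, (a, b)⟩))) ⟨i, (a, b)⟩ = x i a a := by
    intro b
    rw [Pi.basis_repr, Pi.basis_apply, Matrix.stdBasis_eq_single]
    simp [Matrix.stdBasis, Module.Basis.map_repr]
  rw [Finset.sum_congr rfl fun x _ => this x]
  simp [Matrix.diag]

lemma wedd (H : Type*) [Group H] [Fintype H] [DecidableEq H] :
    ∃ (n : ℕ) (d : Fin n → ℕ) (ρ : Π i, H →* Matrix (Fin (d i)) (Fin (d i)) FF),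
      (∀ i, d i ≠ 0) ∧
      (∀ g, ∑ i, (d i : FF) * (ρ i g).trace = if g = 1 then (Fintype.card H : FF) else 0) ∧
      (∀ i M, (∀ g, ρ i g * M = M * ρ i g) → ∃ s : FF, M = s • 1) := by
  classical
  have : NeZero (Nat.card H : FF) := ⟨by simp⟩
  obtain ⟨n, d, hd, ⟨e⟩⟩ :=
    IsSemisimpleRing.exists_algEquiv_pi_matrix_of_isAlgClosed FF (MonoidAlgebra FF H)
  refine ⟨n, d, fun i => ((Pi.evalMonoidHom (fun i => Matrix (Fin (d i)) (Fin (d i)) FF) i).comp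
      (e.toAlgHom : MonoidAlgebra FF H →* _)).comp (MonoidAlgebra.of FF H),
    fun i => (hd i).ne, ?_, ?_⟩
  · intro g
    rw [← trace_group g, ← LinearMap.trace_conj' _ e.toLinearEquiv]
    rw [show (e.toLinearEquiv.conj (LinearMap.mulLeft FF (MonoidAlgebra.of FF H g))) =
      LinearMap.mulLeft FF (e (MonoidAlgebra.of FF H g)) from ?_, trace_mat]
    · rfl
    · refine LinearMap.ext fun x => ?_
      simp [LinearEquiv.conj_apply]
  · intro i M hM
    have h : ∀ y : MonoidAlgebra FF H, e y i * M = M * e y i := by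
      intro y
      induction y using MonoidAlgebra.induction_on with
      | of g => exact hM g
      | add a b ha hb => simp [add_mul, mul_add, ha, hb]
      | smul r a ha => simp [ha]
    have h2 : M ∈ Set.center (Matrix (Fin (d i)) (Fin (d i)) FF) := by
      rw [Semigroup.mem_center_iff]
      intro N
      have := h (e.symm (Pi.single i N))
      simpa using this
    rw [Matrix.center_eq_range] at h2
    obtain ⟨s, hs⟩ := h2
    exact ⟨s, by rw [← hs, Matrix.smul_one_eq_diagonal]; rfl⟩

open Polynomial in
lemma diag {d N : ℕ} (hN : N ≠ 0) (A : Matrix (Fin d) (Fin d) FF) (hA : A ^ N = 1) :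
    ∃ μ : Fin d → FF, (∀ i, μ i ^ N = 1) ∧ (∀ k : ℕ, (A ^ k).trace = ∑ i, μ i ^ k) ∧
      (∀ s : FF, (∀ i, μ i = s) → A = s • 1) := by
  classical
  set f : Module.End FF (Fin d → FF) := Matrix.toLin' A with hf
  have hfk : ∀ k, f ^ k = Matrix.toLin' (A ^ k) := fun k => by rw [hf, Matrix.toLin'_pow]
  have hfN : f ^ N = 1 := by rw [hfk, hA, Matrix.toLin'_one]; rfl
  have hss : f.IsSemisimple := by
    apply Module.End.isSemisimple_of_squarefree_aeval_eq_zero (p := X ^ N - 1)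
    · apply Separable.squarefree
      exact (X_pow_sub_one_separable_iff).2 (by exact_mod_cast hN)
    · simp [hfN]
  have htop : ⨆ μ : FF, f.eigenspace μ = ⊤ := by
    rw [← Module.End.iSup_maxGenEigenspace_eq_top f]
    congr 1; ext1 μ
    exact (hss.isFinitelySemisimple.maxGenEigenspace_eq_eigenspace μ).symm
  have hDSI : DirectSum.IsInternal (fun μ : FF => f.eigenspace μ) :=
    (DirectSum.isInternal_submodule_iff_iSupIndep_and_iSup_eq_top _).2
      ⟨f.eigenspaces_iSupIndep, htop⟩
  let b0 := hDSI.collectedBasis (fun μ => Module.finBasis FF (f.eigenspace μ))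
  have hfin : Finite (Σ μ : FF, Fin (Module.finrank FF (f.eigenspace μ))) :=
    Module.Finite.finite_basis b0
  have := Fintype.ofFinite (Σ μ : FF, Fin (Module.finrank FF (f.eigenspace μ)))
  have hc : Fintype.card (Σ μ : FF, Fin (Module.finrank FF (f.eigenspace μ))) = d := by
    rw [← Module.finrank_eq_card_basis b0]; simp
  let E := Fintype.equivFinOfCardEq hc
  let b := b0.reindex E
  let μ : Fin d → FF := fun i => (E.symm i).1
  have hb : ∀ i, f (b i) = μ i • b i := by
    intro i
    have : b0 (E.symm i) ∈ f.eigenspace (μ i) := hDSI.collectedBasis_mem _ _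
    rw [Module.End.mem_eigenspace_iff] at this
    simpa [b] using this
  have hbk : ∀ k i, (f ^ k) (b i) = (μ i) ^ k • b i := by
    intro k i
    induction k with
    | zero => simp
    | succ k ih => rw [pow_succ', Module.End.mul_apply, ih, map_smul, hb, smul_smul, pow_succ]
  refine ⟨μ, ?_, ?_, ?_⟩
  · intro i
    have h := hbk N i
    rw [hfN] at h
    have h2 : (μ i ^ N - 1) • b i = 0 := by rw [sub_smul, ← h]; simp
    rcases smul_eq_zero.1 h2 with h3 | h3
    · exact sub_eq_zero.1 h3
    · exact absurd h3 (b.ne_zero i)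
  · intro k
    rw [← Matrix.trace_toLin'_eq, ← hfk, LinearMap.trace_eq_matrix_trace FF b, Matrix.trace]
    refine Finset.sum_congr rfl fun i _ => ?_
    simp [LinearMap.toMatrix_apply, hbk]
  · intro s hs
    apply Matrix.toLin'.injective
    change f = _
    apply b.ext
    intro i
    rw [hb, hs]
    simp

lemma FF_alg : Algebra.IsAlgebraic ℚ FF := by
  have h := AlgebraicClosure.isAlgebraic ℚ
  convert! h

lemma burn_norm {α : FF} (hα : IsIntegral ℤ α) (h0 : α ≠ 0)
    (h : ∀ φ : FF →+* ℂ, ‖φ α‖ ≤ 1) (φ : FF →+* ℂ) : ‖φ α‖ = 1 := by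
  have := FF_alg
  let K := IntermediateField.adjoin ℚ {α}
  have hK : FiniteDimensional ℚ K :=
    IntermediateField.adjoin.finiteDimensional (Algebra.IsIntegral.isIntegral α)
  have : NumberField K := ⟨⟩
  have hKa : Algebra.IsAlgebraic K FF := Algebra.IsAlgebraic.tower_top (K := ℚ) K
  let x : K := ⟨α, IntermediateField.mem_adjoin_simple_self ℚ α⟩
  have hx : algebraMap K FF x = α := rfl
  have hxi : IsIntegral ℤ x := by
    rw [← isIntegral_algebraMap_iff (algebraMap K FF).injective (R := ℤ), hx]
    exact hα
  obtain ⟨n, hn, hxn⟩ := NumberField.Embeddings.pow_eq_one_of_norm_le_one (K := K) (A := ℂ) (x := x)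
    (by intro h; apply h0; rw [← hx, h, map_zero]) hxi (by
      intro ψ
      have := h (NumberField.ComplexEmbedding.lift FF ψ)
      rwa [← hx, NumberField.ComplexEmbedding.lift_algebraMap_apply] at this)
  have h1 : α ^ n = 1 := by rw [← hx, ← map_pow, hxn, map_one]
  have h2 : (φ α) ^ n = 1 := by rw [← map_pow, h1, map_one]
  exact Complex.norm_eq_one_of_pow_eq_one h2 hn.ne'

lemma burn_zero {α : FF} (hα : IsIntegral ℤ α)
    (h : ∀ φ : FF →+* ℂ, ‖φ α‖ < 1) : α = 0 := by
  by_contra h0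
  have := FF_alg
  let φ : FF →+* ℂ := (IsAlgClosed.lift (R := ℚ) (S := FF) (M := ℂ)).toRingHom
  have := burn_norm hα h0 (fun φ => (h φ).le) φ
  exact absurd this (h φ).ne

lemma all_eq {d : ℕ} (μ : Fin d → ℂ) (h : ∀ i, ‖μ i‖ = 1) (hd : d ≠ 0)
    (hs : ‖∑ i, μ i‖ = d) (i j : Fin d) : μ i = μ j := by
  have hd' : (d : ℝ) ≠ 0 := by exact_mod_cast hd
  set S := ∑ i, μ i with hS
  let s : ℂ := S / d
  have hs1 : ‖s‖ = 1 := by simp [s, hs, hd]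
  have key : ∀ i, ‖μ i - s‖ ^ 2 = 2 - 2 * (μ i * starRingEnd ℂ s).re := by
    intro i
    rw [← Complex.normSq_eq_norm_sq, Complex.normSq_sub, Complex.normSq_eq_norm_sq,
      Complex.normSq_eq_norm_sq, h i, hs1]
    norm_num
  have hsum : ∑ i, ‖μ i - s‖ ^ 2 = 0 := by
    simp_rw [key]
    rw [Finset.sum_sub_distrib, ← Finset.mul_sum, ← Complex.re_sum, ← Finset.sum_mul, ← hS]
    have : S * starRingEnd ℂ s = d := by
      have h1 : S = d * s := by simp only [s]; field_simp
      rw [h1, mul_assoc, Complex.mul_conj, Complex.normSq_eq_norm_sq, hs1]; simp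
    rw [this]; simp; ring
  have h0 := (Finset.sum_eq_zero_iff_of_nonneg (fun i _ => by positivity)).1 hsum
  have h1 : ∀ i, μ i = s := fun i => by
    have := h0 i (Finset.mem_univ _)
    simpa [sub_eq_zero] using this
  rw [h1, h1]

lemma central_sum {H : Type*} [Group H] [Finite H] {d : ℕ} (hd : d ≠ 0)
    (ρ : H →* Matrix (Fin d) (Fin d) FF)
    (hs : ∀ M, (∀ g, ρ g * M = M * ρ g) → ∃ s : FF, M = s • 1)
    {ι : Type*} [Fintype ι] (x : ι → H) (y : H) (hy : ∀ j, ∃ g, x j = g * y * g⁻¹)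
    (hx : ∀ g, ∃ σ : Equiv.Perm ι, ∀ j, g * x j * g⁻¹ = x (σ j)) :
    ∃ ω : FF, IsIntegral ℤ ω ∧ ∑ j, ρ (x j) = ω • 1 ∧
      (Fintype.card ι : FF) * (ρ y).trace = d * ω := by
  obtain ⟨ω, hω⟩ := hs (∑ j, ρ (x j)) (by
    intro g
    obtain ⟨σ, hσ⟩ := hx g
    rw [Finset.mul_sum, Finset.sum_mul]
    rw [← Equiv.sum_comp σ (fun j => ρ (x j) * ρ g)]
    refine Finset.sum_congr rfl fun j _ => ?_
    rw [← hσ, ← map_mul, ← map_mul]; simp)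
  refine ⟨ω, ?_, hω, ?_⟩
  · have : Nonempty (Fin d) := ⟨⟨0, Nat.pos_of_ne_zero hd⟩⟩
    rw [← isIntegral_algebraMap_iff (R := ℤ) (A := FF) (B := Matrix (Fin d) (Fin d) FF)
      (FaithfulSMul.algebraMap_injective _ _), Algebra.algebraMap_eq_smul_one, ← hω]
    have h1 : IsIntegral ℤ (∑ j, MonoidAlgebra.of ℤ H (x j)) := IsIntegral.of_finite ℤ _
    have h2 := h1.map (MonoidAlgebra.lift ℤ (Matrix (Fin d) (Fin d) FF) H ρ)
    simpa using h2
  · have h := congrArg Matrix.trace hω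
    rw [Matrix.trace_sum, Matrix.trace_smul, Matrix.trace_one] at h
    have : ∀ j, (ρ (x j)).trace = (ρ y).trace := by
      intro j
      obtain ⟨g, hg⟩ := hy j
      rw [hg, map_mul, Matrix.trace_mul_comm, ← map_mul]; simp
    simp only [this] at h
    simp at h
    rw [h]; ring

lemma norm_root {N : ℕ} (hN : N ≠ 0) {μ : FF} (h : μ ^ N = 1) (φ : FF →+* ℂ) : ‖φ μ‖ = 1 :=
  Complex.norm_eq_one_of_pow_eq_one (by rw [← map_pow, h, map_one]) hN

lemma trace_facts {H : Type*} [Group H] [Finite H] {d : ℕ}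
    (ρ : H →* Matrix (Fin d) (Fin d) FF) (g : H) :
    IsIntegral ℤ (ρ g).trace ∧ (∀ φ : FF →+* ℂ, ‖φ (ρ g).trace‖ ≤ d) ∧
    (∀ φ : FF →+* ℂ, φ (ρ g⁻¹).trace = starRingEnd ℂ (φ (ρ g).trace)) ∧
    (∀ φ : FF →+* ℂ, d ≠ 0 → ‖φ (ρ g).trace‖ = d → ∃ s : FF, ρ g = s • 1) := by
  have hN : Nat.card H ≠ 0 := Nat.card_pos.ne'
  obtain ⟨μ, h1, h2, h3⟩ := diag hN (ρ g) (by rw [← map_pow, pow_card_eq_one', map_one])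
  have ht : (ρ g).trace = ∑ i, μ i := by simpa using h2 1
  have hn : ∀ (φ : FF →+* ℂ) i, ‖φ (μ i)‖ = 1 := fun φ i => norm_root hN (h1 i) φ
  refine ⟨?_, ?_, ?_, ?_⟩
  · rw [ht]
    refine IsIntegral.sum _ fun i _ => ?_
    refine IsIntegral.of_pow (Nat.pos_of_ne_zero hN) ?_
    rw [h1]; exact isIntegral_one
  · intro φ
    rw [ht, map_sum]
    refine (norm_sum_le _ _).trans ?_
    simp [hn]
  · intro φ
    have hg : g⁻¹ = g ^ (Nat.card H - 1) := by
      rw [inv_eq_iff_mul_eq_one, ← pow_succ', Nat.sub_add_cancel (Nat.pos_of_ne_zero hN),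
        pow_card_eq_one']
    rw [hg, map_pow, h2, ht, map_sum, map_sum, map_sum]
    refine Finset.sum_congr rfl fun i _ => ?_
    have e1 : φ (μ i ^ (Nat.card H - 1)) * φ (μ i) = 1 := by
      rw [← map_mul, ← pow_succ, Nat.sub_add_cancel (Nat.pos_of_ne_zero hN), h1, map_one]
    have e2 : starRingEnd ℂ (φ (μ i)) * φ (μ i) = 1 := by
      rw [mul_comm, Complex.mul_conj, Complex.normSq_eq_norm_sq, hn]; simp
    have e3 : φ (μ i) ≠ 0 := by
      intro h; rw [h] at e2; simp at e2
    exact mul_right_cancel₀ e3 (e1.trans e2.symm)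
  · intro φ hd hs
    rw [ht, map_sum] at hs
    have := all_eq (fun i => φ (μ i)) (hn φ) hd hs
    refine ⟨μ ⟨0, Nat.pos_of_ne_zero hd⟩, h3 _ fun i => φ.injective (this _ _)⟩

lemma defect_zero {H : Type*} [Group H] [Fintype H] [DecidableEq H] {p : ℕ} (hp : p.Prime)
    (hH : ¬ p ^ 2 ∣ Nat.card H) (c : H) (hc : orderOf c = p)
    (hcc : Nat.card (Subgroup.centralizer {c}) < p ^ 2)
    {n : ℕ} {d : Fin n → ℕ} {ρ : Π i, H →* Matrix (Fin (d i)) (Fin (d i)) FF}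
    (hd : ∀ i, d i ≠ 0)
    (hreg : ∀ g, ∑ i, (d i : FF) * (ρ i g).trace = if g = 1 then (Fintype.card H : FF) else 0)
    (hsch : ∀ i M, (∀ g, ρ i g * M = M * ρ i g) → ∃ s : FF, M = s • 1)
    (i : Fin n) (hi : p ∣ d i) : (ρ i c).trace = 0 := by
  classical
  let K := {x : H // IsConj c x}
  let C := Nat.card (Subgroup.centralizer {c})
  have hKC : Fintype.card K * C = Nat.card H := by
    have h1 := Subgroup.nat_card_centralizer_nat_card_stabilizer c
    have h2 := Nat.card_congr (MulAction.orbitProdStabilizerEquivGroup (ConjAct H) c)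
    have h3 : Nat.card (MulAction.orbit (ConjAct H) c) = Fintype.card K := by
      rw [← Nat.card_eq_fintype_card]
      refine Nat.card_congr (Equiv.subtypeEquivRight fun x => ?_)
      rw [ConjAct.mem_orbit_conjAct]
      exact isConj_comm
    rw [Nat.card_prod, h3] at h2
    have h4 : Nat.card (ConjAct H) = Nat.card H := rfl
    rw [← h4, ← h2]
    congr 1
  have hpC : p ∣ C := by
    rw [← hc, ← Nat.card_zpowers]
    apply Subgroup.card_dvd_of_le
    rw [Subgroup.zpowers_le, Subgroup.mem_centralizer_singleton_iff]
  have hpK : ¬ p ∣ Fintype.card K := by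
    intro h
    apply hH
    rw [← hKC, pow_two]
    exact mul_dvd_mul h hpC
  have hK0 : (Fintype.card K : FF) ≠ 0 := by
    intro h
    apply hpK
    rw [Nat.cast_eq_zero] at h
    rw [h]; simp
  have key : ∀ j, ∃ ω : FF, IsIntegral ℤ ω ∧ ∑ x : K, ρ j x.1 = ω • 1 ∧
      (Fintype.card K : FF) * (ρ j c).trace = d j * ω := by
    intro j
    refine central_sum (hd j) (ρ j) (hsch j) (fun x : K => x.1) c ?_ ?_
    · rintro ⟨x, hx⟩
      obtain ⟨g, hg⟩ := isConj_iff.1 hx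
      exact ⟨g, hg.symm⟩
    · intro g
      refine ⟨(MulAut.conj g).toEquiv.subtypeEquiv ?_, ?_⟩
      · intro x
        have : IsConj x (MulAut.conj g x) := isConj_iff.2 ⟨g, rfl⟩
        exact ⟨fun h => h.trans this, fun h => h.trans this.symm⟩
      · intro j; rfl
  choose ω hω1 hω2 hω3 using key
  have hsum : ∑ j, (ρ j c).trace * (ρ j c⁻¹).trace = (C : FF) := by
    have h1 : ∑ x : K, ∑ j, (d j : FF) * (ρ j (x.1 * c⁻¹)).trace = Fintype.card H := by
      simp only [hreg]
      rw [Finset.sum_eq_single (⟨c, IsConj.refl c⟩ : K)]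
      · simp
      · rintro ⟨x, hx⟩ _ hne
        rw [if_neg]
        intro h
        apply hne
        ext
        exact mul_inv_eq_one.1 h
      · simp
    rw [Finset.sum_comm] at h1
    have h2 : ∀ j, ∑ x : K, (d j : FF) * (ρ j (x.1 * c⁻¹)).trace =
        Fintype.card K * ((ρ j c).trace * (ρ j c⁻¹).trace) := by
      intro j
      rw [← Finset.mul_sum, ← Matrix.trace_sum]
      simp only [map_mul]
      rw [← Finset.sum_mul, hω2, ← mul_assoc, hω3]
      simp [mul_assoc]
    simp only [h2] at h1
    rw [← Finset.mul_sum, ← Nat.card_eq_fintype_card (α := H), ← hKC] at h1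
    push_cast at h1
    simpa [hK0] using h1
  have hp0 : (p : FF) ≠ 0 := by exact_mod_cast hp.ne_zero
  have hβ : (ρ i c).trace / p = 0 := by
    apply burn_zero
    · have hcop : IsCoprime (Fintype.card K : ℤ) (p : ℤ) := by
        rw [Nat.isCoprime_iff_coprime]
        exact ((Nat.Prime.coprime_iff_not_dvd hp).2 hpK).symm
      obtain ⟨u, v, huv⟩ := hcop
      obtain ⟨e, he⟩ := hi
      have h1 : (u : FF) * Fintype.card K + v * p = 1 := by exact_mod_cast congrArg (Int.cast : ℤ → FF) huv
      have h2 := hω3 i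
      have he' : (d i : FF) = p * e := by rw [he]; push_cast; rfl
      have : (ρ i c).trace / p = u * (e * ω i) + v * (ρ i c).trace := by
        field_simp
        linear_combination (-(ρ i c).trace) * h1 + u * h2 + u * ω i * he'
      rw [this]
      have hi1 : IsIntegral ℤ (u : FF) := isIntegral_algebraMap (R := ℤ) (x := u)
      have hi2 : IsIntegral ℤ (v : FF) := isIntegral_algebraMap (R := ℤ) (x := v)
      have hi3 : IsIntegral ℤ (e : FF) := by
        simpa using isIntegral_algebraMap (R := ℤ) (A := FF) (x := (e : ℤ))
      exact (hi1.mul (hi3.mul (hω1 i))).add (hi2.mul (trace_facts (ρ i) c).1)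
    · intro φ
      have h1 := congrArg φ hsum
      rw [map_sum] at h1
      have h2 : ∀ j, φ ((ρ j c).trace * (ρ j c⁻¹).trace) = ((‖φ (ρ j c).trace‖ ^ 2 : ℝ) : ℂ) := by
        intro j
        rw [map_mul, (trace_facts (ρ j) c).2.2.1 φ, Complex.mul_conj, Complex.normSq_eq_norm_sq]
      simp only [h2] at h1
      rw [← Complex.ofReal_sum, map_natCast] at h1
      have h3 : ∑ j, ‖φ (ρ j c).trace‖ ^ 2 = (C : ℝ) := by exact_mod_cast h1
      have h4 : ‖φ (ρ i c).trace‖ ^ 2 ≤ (C : ℝ) := by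
        rw [← h3]
        exact Finset.single_le_sum (f := fun j => ‖φ (ρ j c).trace‖ ^ 2)
          (fun j _ => by positivity) (Finset.mem_univ i)
      have h5 : (C : ℝ) < (p : ℝ) ^ 2 := by exact_mod_cast hcc
      have h6 : ‖φ (ρ i c).trace‖ < p := lt_of_pow_lt_pow_left₀ 2 (by positivity) (h4.trans_lt h5)
      rw [map_div₀, norm_div, map_natCast, Complex.norm_natCast, div_lt_one]
      · exact h6
      · exact_mod_cast hp.pos
  field_simp at hβ
  simpa using hβ

lemma piece {H : Type*} [Group H] [Fintype H] {p : ℕ} (hp : p.Prime) {d : ℕ} (hd : d ≠ 0)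
    (ρ : H →* Matrix (Fin d) (Fin d) FF)
    (hs : ∀ M, (∀ g, ρ g * M = M * ρ g) → ∃ s : FF, M = s • 1)
    {Q : Type*} [Fintype Q] (hQ : Fintype.card Q = p) (L : Q → H)
    (hσ : ∀ g, ∃ σ : Equiv.Perm Q, ∀ j, g * L j * g⁻¹ = L (σ j))
    (hconj : ∀ a b, ∃ g, L a = g * L b * g⁻¹) (c : H)
    (hc : c ∈ Subgroup.closure {g | ∃ a b, g = L a * (L b)⁻¹})
    (hdef : p ∣ d → (ρ c).trace = 0) :
    ∃ m : ℕ, (d : FF) * ∑ a, ∑ b, (ρ (L a * (L b)⁻¹ * c)).trace = m ∧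
      ((∀ g, ρ g = 1) → m ≠ 0) := by
  have hQ0 : Nonempty Q := by
    rw [← Fintype.card_pos_iff, hQ]; exact hp.pos
  obtain ⟨q⟩ := hQ0
  have hp0 : (p : FF) ≠ 0 := by exact_mod_cast hp.ne_zero
  have hd0 : (d : FF) ≠ 0 := by exact_mod_cast hd
  obtain ⟨ω, hω1, hω2, hω3⟩ := central_sum hd ρ hs L (L q) (fun j => hconj j q) hσ
  obtain ⟨ω', hω1', hω2', hω3'⟩ := central_sum hd ρ hs (fun a => (L a)⁻¹) (L q)⁻¹
    (fun j => by
      obtain ⟨g, hg⟩ := hconj j q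
      exact ⟨g, by rw [hg]; group⟩)
    (fun g => by
      obtain ⟨σ, h⟩ := hσ g
      exact ⟨σ, fun j => by rw [← h]; group⟩)
  rw [hQ] at hω3 hω3'
  have hT : (d : FF) * ∑ a, ∑ b, (ρ (L a * (L b)⁻¹ * c)).trace = d * ω * ω' * (ρ c).trace := by
    simp only [← Matrix.trace_sum, map_mul, ← Finset.sum_mul, ← Finset.mul_sum]
    rw [hω2', hω2]
    simp [mul_assoc]
    left
    ring
  rw [hT]
  by_cases hpd : p ∣ d
  · refine ⟨0, by rw [hdef hpd]; simp, ?_⟩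
    intro h1
    have := hdef hpd
    rw [h1] at this
    simp at this
    exact absurd this hd
  -- the quotient is integral
  have hcop : IsCoprime (p : ℤ) (d : ℤ) := by
    rw [Nat.isCoprime_iff_coprime]
    exact (Nat.Prime.coprime_iff_not_dvd hp).2 hpd
  obtain ⟨u, v, huv⟩ := hcop
  have h1 : (u : FF) * p + v * d = 1 := by exact_mod_cast congrArg (Int.cast : ℤ → FF) huv
  have hα : IsIntegral ℤ ((ρ (L q)).trace / d) := by
    have : (ρ (L q)).trace / d = u * ω + v * (ρ (L q)).trace := by
      field_simp
      linear_combination (-(ρ (L q)).trace) * h1 + u * hω3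
    rw [this]
    have hi1 : IsIntegral ℤ (u : FF) := isIntegral_algebraMap (R := ℤ) (x := u)
    have hi2 : IsIntegral ℤ (v : FF) := isIntegral_algebraMap (R := ℤ) (x := v)
    exact (hi1.mul hω1).add (hi2.mul (trace_facts ρ (L q)).1)
  by_cases hz : (ρ (L q)).trace = 0
  · refine ⟨0, ?_, ?_⟩
    · rw [hz] at hω3
      have : ω = 0 := by simpa [hd0] using hω3.symm
      simp [this]
    · intro h1
      rw [h1] at hz
      simp at hz
      exact absurd hz hd
  have := FF_alg
  let φ : FF →+* ℂ := (IsAlgClosed.lift (R := ℚ) (S := FF) (M := ℂ)).toRingHom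
  have hdR : (0 : ℝ) < d := by exact_mod_cast Nat.pos_of_ne_zero hd
  have hnorm := burn_norm hα (div_ne_zero hz hd0) (fun φ => by
    rw [map_div₀, norm_div, map_natCast, Complex.norm_natCast, div_le_one hdR]
    exact (trace_facts ρ (L q)).2.1 φ) φ
  rw [map_div₀, norm_div, map_natCast, Complex.norm_natCast, div_eq_one_iff_eq hdR.ne'] at hnorm
  obtain ⟨s, hsc⟩ := (trace_facts ρ (L q)).2.2.2 φ hd hnorm
  have hinv : ∀ g, ρ g * ρ g⁻¹ = 1 := fun g => by rw [← map_mul]; simp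
  have hL : ∀ a, ρ (L a) = s • 1 := by
    intro a
    obtain ⟨g, hg⟩ := hconj a q
    rw [hg, map_mul, map_mul, hsc]
    simp [hinv]
  have hLL : ∀ a b, ρ (L a * (L b)⁻¹) = 1 := by
    intro a b
    rw [map_mul, hL a, ← hL b, hinv]
  have hρc : ρ c = 1 := by
    have : Subgroup.closure {g | ∃ a b, g = L a * (L b)⁻¹} ≤ ρ.ker := by
      rw [Subgroup.closure_le]
      rintro _ ⟨a, b, rfl⟩
      exact hLL a b
    exact this hc
  refine ⟨p ^ 2 * d ^ 2, ?_, fun _ => by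
    have := hp.ne_zero
    positivity⟩
  rw [← hT]
  simp only [map_mul ρ _ c, hLL, hρc]
  simp [hQ]
  ring

lemma triv_exists {H : Type*} [Group H] [Fintype H] [DecidableEq H]
    {n : ℕ} {d : Fin n → ℕ} {ρ : Π i, H →* Matrix (Fin (d i)) (Fin (d i)) FF}
    (hreg : ∀ g, ∑ i, (d i : FF) * (ρ i g).trace = if g = 1 then (Fintype.card H : FF) else 0)
    (hsch : ∀ i M, (∀ g, ρ i g * M = M * ρ i g) → ∃ s : FF, M = s • 1) :
    ∃ i, ∀ g, ρ i g = 1 := by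
  have h0 : ∑ i, (d i : FF) * (∑ g, ρ i g).trace ≠ 0 := by
    simp only [Matrix.trace_sum, Finset.mul_sum]
    rw [Finset.sum_comm]
    simp only [hreg]
    simp
  obtain ⟨i, -, hi⟩ := Finset.exists_ne_zero_of_sum_ne_zero h0
  refine ⟨i, ?_⟩
  have hl : ∀ h, ρ i h * ∑ g, ρ i g = ∑ g, ρ i g := by
    intro h
    rw [Finset.mul_sum]
    simp only [← map_mul]
    exact Fintype.sum_equiv (Equiv.mulLeft h) _ _ (fun x => rfl)
  have hr : ∀ h, (∑ g, ρ i g) * ρ i h = ∑ g, ρ i g := by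
    intro h
    rw [Finset.sum_mul]
    simp only [← map_mul]
    exact Fintype.sum_equiv (Equiv.mulRight h) _ _ (fun x => rfl)
  obtain ⟨s, hs⟩ := hsch i (∑ g, ρ i g) (fun g => by rw [hl, hr])
  have hs0 : s ≠ 0 := by
    rintro rfl
    apply hi
    rw [hs]; simp
  intro g
  have := hl g
  rw [hs] at this
  simp only [Matrix.mul_smul, mul_one] at this
  exact smul_right_injective _ hs0 this

theorem thmB {H : Type*} [Group H] [Finite H] {p : ℕ} (hp : p.Prime)
    (hH : ¬ p ^ 2 ∣ Nat.card H) (c : H) (hc : orderOf c = p)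
    (hcc : Nat.card (Subgroup.centralizer {c}) < p ^ 2)
    {Q : Type*} [Finite Q] (hQ : Nat.card Q = p) (L : Q → H)
    (hσ : ∀ g, ∃ σ : Equiv.Perm Q, ∀ j, g * L j * g⁻¹ = L (σ j))
    (hconj : ∀ a b, ∃ g, L a = g * L b * g⁻¹)
    (hcm : c ∈ Subgroup.closure {g | ∃ a b, g = L a * (L b)⁻¹}) :
    ∃ a b, L a * (L b)⁻¹ = c := by
  classical
  have := Fintype.ofFinite H
  have := Fintype.ofFinite Q
  rw [Nat.card_eq_fintype_card] at hQ
  obtain ⟨n, d, ρ, hd, hreg, hsch⟩ := wedd H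
  by_contra hne
  push Not at hne
  have hp1 := fun i => piece hp (hd i) (ρ i) (hsch i) hQ L hσ hconj c hcm
    (defect_zero hp hH c hc hcc hd hreg hsch i)
  choose m hm1 hm2 using hp1
  obtain ⟨i0, hi0⟩ := triv_exists hreg hsch
  have hsum : ∑ i, (m i : FF) = 0 := by
    simp only [← hm1, Finset.mul_sum]
    rw [Finset.sum_comm]
    refine Finset.sum_eq_zero fun a _ => ?_
    rw [Finset.sum_comm]
    refine Finset.sum_eq_zero fun b _ => ?_
    rw [hreg, if_neg]
    intro h
    apply hne b a
    rw [eq_inv_of_mul_eq_one_right h]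
    group
  rw [← Nat.cast_sum, Nat.cast_eq_zero, Finset.sum_eq_zero_iff] at hsum
  exact hm2 i0 hi0 (hsum i0 (Finset.mem_univ _))

theorem thmC {B : Type*} [Finite B] {p : ℕ} (hp : p.Prime) (hB : Nat.card B = p)
    (L : B → Equiv.Perm B) (hL : ∀ a b, L (L a b) = L a * L b * (L a)⁻¹)
    (htr : ∀ x y, ∃ g ∈ Subgroup.closure {g | ∃ a b, g = L a * (L b)⁻¹}, g x = y) :
    ∃ c ∈ Subgroup.closure {g | ∃ a b, g = L a * (L b)⁻¹},
      Subgroup.closure {g | ∃ a b, g = L a * (L b)⁻¹} ≤ Subgroup.zpowers c := by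
  classical
  have := Fintype.ofFinite B
  set D := Subgroup.closure {g | ∃ a b, g = L a * (L b)⁻¹} with hD
  have hne : Nonempty B := (Nat.card_pos_iff.1 (by rw [hB]; exact hp.pos)).1
  obtain ⟨x0⟩ := hne
  let H : Subgroup (Equiv.Perm B) :=
    { carrier := {g | ∀ a, g * L a * g⁻¹ = L (g a)}
      one_mem' := by intro a; simp
      mul_mem' := by
        intro g h hg hh a
        rw [Equiv.Perm.mul_apply, ← hg, ← hh]; group
      inv_mem' := by
        intro g hg a
        have := hg (g⁻¹ a)
        have e : g (g⁻¹ a) = a := Equiv.apply_symm_apply g a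
        rw [e] at this
        rw [← this]; group }
  have hLH : ∀ a, L a ∈ H := fun a b => (hL a b).symm
  have hDH : D ≤ H := by
    rw [hD, Subgroup.closure_le]
    rintro _ ⟨a, b, rfl⟩
    exact H.mul_mem (hLH a) (H.inv_mem (hLH b))
  -- an element of order p
  have hpD : p ∣ Nat.card D := by
    have : MulAction.IsPretransitive D B := ⟨fun x y => by
      obtain ⟨g, hg, h⟩ := htr x y
      exact ⟨⟨g, hg⟩, h⟩⟩
    rw [← hB, ← MulAction.index_stabilizer_of_transitive D x0]
    exact Subgroup.index_dvd_card _
  have := Fact.mk hp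
  obtain ⟨⟨c, hcD⟩, hc⟩ := exists_prime_orderOf_dvd_card' p hpD
  rw [Subgroup.orderOf_mk] at hc
  have hcB : orderOf c = Fintype.card B := by rw [hc, ← hB, Nat.card_eq_fintype_card]
  have hpB : (Fintype.card B).Prime := by rw [← hcB, hc]; exact hp
  have hcyc : c.IsCycle := Equiv.Perm.isCycle_of_prime_order'' hpB hcB
  have hsupp : c.support = Finset.univ := by
    rw [← Finset.card_eq_iff_eq_univ, ← hcyc.orderOf, hcB]
  have hmove : ∀ x, c x ≠ x := fun x => by
    rw [← Equiv.Perm.mem_support, hsupp]; exact Finset.mem_univ x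
  have hct : ∀ x y, ∃ i : ℤ, (c ^ i) x = y := fun x y => hcyc.sameCycle (hmove x) (hmove y)
  have hH : ¬ p ^ 2 ∣ Nat.card H := by
    intro h
    have h1 : p ^ 2 ∣ p.factorial := by
      refine h.trans ((Subgroup.card_subgroup_dvd_card H).trans ?_)
      rw [Nat.card_perm, hB]
    have h2 : p.factorial = p * (p - 1).factorial := (Nat.mul_factorial_pred hp.ne_zero).symm
    rw [h2, pow_two] at h1
    have h3 := Nat.dvd_of_mul_dvd_mul_left hp.pos h1
    rw [hp.dvd_factorial] at h3
    have := hp.pos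
    omega
  have hmap : Subgroup.map H.subtype
      (Subgroup.closure {g : H | ∃ a b, g = (⟨L a, hLH a⟩ : H) * (⟨L b, hLH b⟩ : H)⁻¹}) = D := by
    rw [MonoidHom.map_closure, hD]
    congr 1
    ext g
    constructor
    · rintro ⟨_, ⟨a, b, rfl⟩, rfl⟩
      exact ⟨a, b, rfl⟩
    · rintro ⟨a, b, rfl⟩
      exact ⟨_, ⟨a, b, rfl⟩, rfl⟩
  have hcD2 := hcD
  rw [← hmap] at hcD2
  obtain ⟨c', hc', hcc'⟩ := hcD2
  have hcc2 : (c' : Equiv.Perm B) = c := hcc'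
  have hcent : Nat.card (Subgroup.centralizer {c'}) < p ^ 2 := by
    have h1 : Nat.card (Subgroup.centralizer {c'}) ≤ Nat.card B := by
      refine Nat.card_le_card_of_injective (fun g => (g.1 : Equiv.Perm B) x0) ?_
      have hcomm : ∀ g : Subgroup.centralizer {c'}, Commute (g.1 : Equiv.Perm B) c := by
        intro g
        have := Subgroup.mem_centralizer_singleton_iff.1 g.2
        rw [← hcc2]
        exact congrArg Subtype.val this
      intro g h hgh
      ext y
      obtain ⟨i, rfl⟩ := hct x0 y
      have e1 : ∀ g : Subgroup.centralizer {c'}, (g.1 : Equiv.Perm B) ((c ^ i) x0) =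
          (c ^ i) ((g.1 : Equiv.Perm B) x0) := fun g => by
        rw [← Equiv.Perm.mul_apply, ((hcomm g).zpow_right i).eq, Equiv.Perm.mul_apply]
      rw [e1, e1]
      exact congrArg _ hgh
    rw [hB] at h1
    have := hp.one_lt
    nlinarith
  obtain ⟨a, b, hab⟩ := thmB hp hH c' (by rw [← Subgroup.orderOf_coe, hcc2, hc]) hcent hB
    (fun a => (⟨L a, hLH a⟩ : H))
    (fun g => ⟨g.1, fun j => Subtype.ext (g.2 j)⟩)
    (fun a b => by
      obtain ⟨g, hg, rfl⟩ := htr b a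
      exact ⟨⟨g, hDH hg⟩, Subtype.ext (hDH hg b).symm⟩)
    hc'
  have hab2 : L a * (L b)⁻¹ = c := by rw [← hcc2, ← hab]; rfl
  refine ⟨c, hcD, ?_⟩
  obtain ⟨i, hi⟩ := hct b a
  have hPH : ∀ i : ℤ, c ^ i ∈ H := fun i => H.zpow_mem (hDH hcD) i
  have ht1 : c ^ i ≠ 1 := by
    intro h
    rw [h] at hi
    have hi' : b = a := hi
    rw [hi', mul_inv_cancel] at hab2
    rw [← hab2, orderOf_one] at hc
    exact hp.one_lt.ne hc
  have hz : ∀ s ∈ Subgroup.zpowers c, L b * s * (L b)⁻¹ ∈ Subgroup.zpowers c := by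
    have hle : Subgroup.zpowers (c ^ i)⁻¹ ≤ Subgroup.zpowers c := by
      rw [Subgroup.zpowers_le]
      exact inv_mem (Subgroup.zpow_mem_zpowers c i)
    have heq : Subgroup.zpowers (c ^ i)⁻¹ = Subgroup.zpowers c := by
      apply Subgroup.eq_of_le_of_card_ge hle
      rw [Nat.card_zpowers, Nat.card_zpowers, hc, orderOf_inv, orderOf_eq_prime (p := p) _ ht1]
      rw [← zpow_natCast, zpow_comm, zpow_natCast, ← hc, pow_orderOf_eq_one, one_zpow]
    have h1 : Subgroup.zpowers (c ^ i)⁻¹ ≤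
        (Subgroup.zpowers c).comap (MulAut.conj (L b)).toMonoidHom := by
      rw [Subgroup.zpowers_le]
      change L b * (c ^ i)⁻¹ * (L b)⁻¹ ∈ Subgroup.zpowers c
      have h2 := hPH i b
      rw [hi] at h2
      have : L b * (c ^ i)⁻¹ * (L b)⁻¹ = (c ^ i)⁻¹ * c := by
        have h3 : L b * (c ^ i)⁻¹ * (L b)⁻¹ =
            (c ^ i)⁻¹ * (c ^ i * L b * (c ^ i)⁻¹ * (L b)⁻¹) := by group
        rw [h3, h2, hab2]
      rw [this]
      exact mul_mem (inv_mem (Subgroup.zpow_mem_zpowers c i)) (Subgroup.mem_zpowers c)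
    rw [heq] at h1
    exact fun s hs => h1 hs
  have hx : ∀ x, L x * (L b)⁻¹ ∈ Subgroup.zpowers c := by
    intro x
    obtain ⟨j, rfl⟩ := hct b x
    rw [← hPH j b]
    have : c ^ j * L b * (c ^ j)⁻¹ * (L b)⁻¹ = c ^ j * (L b * (c ^ j)⁻¹ * (L b)⁻¹) := by group
    rw [this]
    exact mul_mem (Subgroup.zpow_mem_zpowers c j)
      (hz _ (inv_mem (Subgroup.zpow_mem_zpowers c j)))
  rw [hD, Subgroup.closure_le]
  rintro _ ⟨x, y, rfl⟩
  have : L x * (L y)⁻¹ = (L x * (L b)⁻¹) * (L y * (L b)⁻¹)⁻¹ := by group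
  rw [SetLike.mem_coe, this]
  exact mul_mem (hx x) (inv_mem (hx y))

lemma grp_one {G : Type*} [Group G] (K : Subgroup G) [hK : K.Normal]
    (hab : ∀ k ∈ K, ∀ l ∈ K, k * l = l * k) (g₀ : G)
    (hgen : ∀ g, ∃ k ∈ K, ∃ i : ℤ, g = k * g₀ ^ i) :
    ∀ x ∈ commutator G, ∃ k ∈ K, x = k * g₀ * k⁻¹ * g₀⁻¹ := by
  have hfK : ∀ k ∈ K, k * g₀ * k⁻¹ * g₀⁻¹ ∈ K := fun k hk => by
    have : k * g₀ * k⁻¹ * g₀⁻¹ = k * (g₀ * k⁻¹ * g₀⁻¹) := by group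
    rw [this]
    exact K.mul_mem hk (hK.conj_mem _ (K.inv_mem hk) _)
  have hmul : ∀ k ∈ K, ∀ l ∈ K, (k * l) * g₀ * (k * l)⁻¹ * g₀⁻¹ =
      (k * g₀ * k⁻¹ * g₀⁻¹) * (l * g₀ * l⁻¹ * g₀⁻¹) := by
    intro k hk l hl
    have e1 : (k * l) * g₀ * (k * l)⁻¹ * g₀⁻¹ =
      k * (l * g₀ * l⁻¹ * g₀⁻¹) * (g₀ * k⁻¹ * g₀⁻¹) := by group
    rw [e1, hab k hk _ (hfK l hl), mul_assoc, hab _ (hfK l hl) _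
      (K.mul_mem hk (hK.conj_mem _ (K.inv_mem hk) _))]
    group
  let J : Subgroup G :=
    { carrier := {x | ∃ k ∈ K, x = k * g₀ * k⁻¹ * g₀⁻¹}
      one_mem' := ⟨1, K.one_mem, by group⟩
      mul_mem' := by
        rintro _ _ ⟨k, hk, rfl⟩ ⟨l, hl, rfl⟩
        exact ⟨k * l, K.mul_mem hk hl, (hmul k hk l hl).symm⟩
      inv_mem' := by
        rintro _ ⟨k, hk, rfl⟩
        refine ⟨k⁻¹, K.inv_mem hk, ?_⟩
        rw [inv_eq_iff_mul_eq_one, ← hmul k hk _ (K.inv_mem hk)]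
        group }
  have hJ1 : ∀ k ∈ K, ∀ x ∈ J, k * x * k⁻¹ = x := by
    rintro k hk _ ⟨l, hl, rfl⟩
    rw [hab k hk _ (hfK l hl)]; group
  have hJ2 : ∀ i : ℤ, ∀ x ∈ J, g₀ ^ i * x * (g₀ ^ i)⁻¹ ∈ J := by
    rintro i _ ⟨l, hl, rfl⟩
    refine ⟨g₀ ^ i * l * (g₀ ^ i)⁻¹, hK.conj_mem _ hl _, ?_⟩
    group
  have hJn : J.Normal := ⟨by
    intro x hx g
    obtain ⟨k, hk, i, rfl⟩ := hgen g
    have : k * g₀ ^ i * x * (k * g₀ ^ i)⁻¹ = k * (g₀ ^ i * x * (g₀ ^ i)⁻¹) * k⁻¹ := by group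
    rw [this, hJ1 k hk _ (hJ2 i x hx)]
    exact hJ2 i x hx⟩
  have hq1 : ∀ k ∈ K, ∀ i : ℤ, Commute (QuotientGroup.mk' J k) (QuotientGroup.mk' J g₀ ^ i) := by
    intro k hk i
    apply Commute.zpow_right
    have : QuotientGroup.mk' J (k * g₀ * k⁻¹ * g₀⁻¹) = 1 :=
      (QuotientGroup.eq_one_iff _).2 ⟨k, hk, rfl⟩
    simp only [map_mul, map_inv] at this
    rw [mul_inv_eq_one, mul_inv_eq_iff_eq_mul] at this
    exact this
  have hq2 : ∀ k ∈ K, ∀ l ∈ K, Commute (QuotientGroup.mk' J k) (QuotientGroup.mk' J l) := by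
    intro k hk l hl
    unfold Commute SemiconjBy
    rw [← map_mul, hab k hk l hl, map_mul]
  have hle : commutator G ≤ J := by
    rw [commutator_def, Subgroup.commutator_le]
    intro g _ h _
    obtain ⟨k, hk, i, rfl⟩ := hgen g
    obtain ⟨l, hl, j, rfl⟩ := hgen h
    rw [← QuotientGroup.eq_one_iff]
    change QuotientGroup.mk' J _ = 1
    rw [map_commutatorElement, commutatorElement_eq_one_iff_commute]
    simp only [map_mul, map_zpow]
    refine Commute.mul_left (Commute.mul_right (hq2 k hk l hl) (hq1 k hk j))
      (Commute.mul_right (hq1 l hl i).symm ?_)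
    exact ((Commute.refl _).zpow_left i).zpow_right j
  intro x hx
  exact hle hx

lemma grp_two {G : Type*} [Group G] [Finite G] (φ : G →* G) (S : Subgroup G)
    (hfix : ∀ s ∈ S, φ s = s)
    (hgen : Subgroup.closure {x | ∃ h, x = h * (φ h)⁻¹} = ⊤) : S ≤ commutator G := by
  let ψ : Abelianization G →* Abelianization G := Abelianization.map φ
  let θ : Abelianization G →* Abelianization G := MonoidHom.id _ / ψ
  have hθ : ∀ g, θ (Abelianization.of g) = Abelianization.of (g * (φ g)⁻¹) := by
    intro g
    simp [θ, ψ, div_eq_mul_inv]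
  have hfin : Finite (Abelianization G) := inferInstanceAs (Finite (G ⧸ commutator G))
  have hsurj : Function.Surjective θ := by
    rw [← MonoidHom.range_eq_top, eq_top_iff]
    have h1 : (⊤ : Subgroup G) ≤ θ.range.comap Abelianization.of := by
      rw [← hgen, Subgroup.closure_le]
      rintro _ ⟨h, rfl⟩
      exact ⟨Abelianization.of h, hθ h⟩
    intro x _
    obtain ⟨g, rfl⟩ := QuotientGroup.mk_surjective x
    exact h1 (Subgroup.mem_top g)
  have hinj := Finite.injective_iff_surjective.2 hsurj
  intro s hs
  have h1 : Abelianization.of s = 1 := by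
    apply hinj
    rw [hθ, hfix s hs]; simp
  exact (QuotientGroup.eq_one_iff s).1 h1

lemma grp_three {G Q : Type*} [Group G] [Finite G] [MulAction G Q] [FaithfulSMul G Q]
    (htr : ∀ x y : Q, ∃ g : G, g • x = y) (a : Q) (φ : G →* G)
    (hfix : ∀ g : G, g • a = a → φ g = g)
    (hgen : Subgroup.closure {x | ∃ h, x = h * (φ h)⁻¹} = ⊤) (g₀ : G)
    (hX1 : ∀ g : G, ∃ i : ℤ, ∀ x : Q, ∃ z ∈ Subgroup.center G, (g * (g₀ ^ i)⁻¹) • x = z • x) :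
    ∀ g : G, g ∈ Subgroup.center G := by
  have hZ : ∀ z ∈ Subgroup.center G, ∀ g : G, ∀ x : Q, g • z • x = z • g • x := by
    intro z hz g x
    rw [smul_smul, smul_smul, Subgroup.mem_center_iff.1 hz g]
  let K : Subgroup G :=
    { carrier := {g | ∀ x : Q, ∃ z ∈ Subgroup.center G, g • x = z • x}
      one_mem' := fun x => ⟨1, one_mem _, rfl⟩
      mul_mem' := by
        intro k l hk hl x
        obtain ⟨w, hw, h1⟩ := hl x
        obtain ⟨z, hz, h2⟩ := hk x
        refine ⟨w * z, mul_mem hw hz, ?_⟩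
        rw [mul_smul, h1, hZ w hw, h2, mul_smul]
      inv_mem' := by
        intro k hk x
        obtain ⟨z, hz, h2⟩ := hk x
        refine ⟨z⁻¹, inv_mem hz, ?_⟩
        rw [inv_smul_eq_iff, hZ _ (inv_mem hz), h2, inv_smul_smul] }
  have hKn : K.Normal := ⟨by
    intro k hk g x
    obtain ⟨z, hz, h⟩ := hk (g⁻¹ • x)
    refine ⟨z, hz, ?_⟩
    rw [mul_smul, mul_smul, h, hZ z hz, smul_inv_smul]⟩
  have hKab : ∀ k ∈ K, ∀ l ∈ K, k * l = l * k := by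
    intro k hk l hl
    apply eq_of_smul_eq_smul (α := Q)
    intro x
    obtain ⟨z, hz, h1⟩ := hk x
    obtain ⟨w, hw, h2⟩ := hl x
    rw [mul_smul, mul_smul, h1, h2, hZ w hw, hZ z hz, h1, h2, hZ z hz]
  have hKg : ∀ g, ∃ k ∈ K, ∃ i : ℤ, g = k * g₀ ^ i := by
    intro g
    obtain ⟨i, hi⟩ := hX1 g
    exact ⟨_, hi, i, by group⟩
  have hcomm := grp_one K hKab g₀ hKg
  let S := MulAction.stabilizer G a
  have hSc : S ≤ commutator G := grp_two φ S (fun s hs => hfix s hs) hgen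
  have hKS : ∀ k ∈ K, ∃ z ∈ Subgroup.center G, ∃ s ∈ S, k = z * s := by
    intro k hk
    obtain ⟨z, hz, h⟩ := hk a
    refine ⟨z, hz, z⁻¹ * k, ?_, by group⟩
    rw [MulAction.mem_stabilizer_iff, mul_smul, h, inv_smul_smul]
  have hcard : Nat.card (commutator G) ≤ Nat.card S := by
    have h1 : ∀ x : commutator G, ∃ s : S, x.1 = s.1 * g₀ * s.1⁻¹ * g₀⁻¹ := by
      intro x
      obtain ⟨k, hk, h⟩ := hcomm x.1 x.2
      obtain ⟨z, hz, s, hs, rfl⟩ := hKS k hk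
      refine ⟨⟨s, hs⟩, ?_⟩
      rw [h]
      have := Subgroup.mem_center_iff.1 hz (s * g₀ * s⁻¹)
      calc z * s * g₀ * (z * s)⁻¹ * g₀⁻¹ = (z * (s * g₀ * s⁻¹)) * z⁻¹ * g₀⁻¹ := by group
        _ = _ := by rw [← this]; group
    choose f hf using h1
    refine Nat.card_le_card_of_injective f ?_
    intro x y hxy
    apply Subtype.ext
    rw [hf x, hf y, hxy]
  have hSeq : S = commutator G := Subgroup.eq_of_le_of_card_ge hSc hcard
  have hSn : S.Normal := by rw [hSeq]; infer_instance
  have hS1 : ∀ s ∈ S, s = 1 := by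
    intro s hs
    apply eq_of_smul_eq_smul (α := Q)
    intro x
    obtain ⟨h, rfl⟩ := htr a x
    have h1 := hSn.conj_mem s hs h⁻¹
    rw [MulAction.mem_stabilizer_iff, inv_inv, mul_smul, mul_smul, inv_smul_eq_iff] at h1
    rw [h1, one_smul]
  have hKZ : ∀ k ∈ K, k ∈ Subgroup.center G := by
    intro k hk
    obtain ⟨z, hz, s, hs, rfl⟩ := hKS k hk
    rw [hS1 s hs, mul_one]; exact hz
  intro g
  rw [Subgroup.mem_center_iff]
  intro h
  obtain ⟨k, hk, i, rfl⟩ := hKg g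
  obtain ⟨l, hl, j, rfl⟩ := hKg h
  have c1 : ∀ x, Commute x k := fun x => Subgroup.mem_center_iff.1 (hKZ k hk) x
  have c2 : ∀ x, Commute x l := fun x => Subgroup.mem_center_iff.1 (hKZ l hl) x
  have c3 : Commute (g₀ ^ j) (g₀ ^ i) := ((Commute.refl _).zpow_left j).zpow_right i
  exact Commute.mul_right (c1 _) (Commute.mul_left (c2 _).symm c3)

lemma descend {Q : Type*} (H Z : Subgroup (Equiv.Perm Q))
    (hn : ∀ h ∈ H, ∀ z ∈ Z, h * z * h⁻¹ ∈ Z) :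
    ∃ π : H →* Equiv.Perm (Quotient (MulAction.orbitRel Z Q)),
      ∀ (h : H) (x : Q), π h (Quotient.mk _ x) = Quotient.mk _ (h.1 x) := by
  let A : MulAction H (Quotient (MulAction.orbitRel Z Q)) :=
    { smul := fun h => Quotient.map h.1 (by
        rintro x y ⟨⟨z, hz⟩, rfl⟩
        refine ⟨⟨h.1 * z * h.1⁻¹, hn h.1 h.2 z hz⟩, ?_⟩
        change h.1 (z (h.1.symm (h.1 y))) = h.1 (z y)
        rw [Equiv.symm_apply_apply])
      one_smul := by
        intro x
        induction x using Quotient.inductionOn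
        rfl
      mul_smul := by
        intro g h x
        induction x using Quotient.inductionOn
        rfl }
  exact ⟨MulAction.toPermHom H _, fun h x => rfl⟩

lemma QL_conj {Q : Type*} [Quandle Q] (a b : Q) : QL (QL a b) = QL a * QL b * (QL a)⁻¹ :=
  Rack.ad_conj a b

theorem stmt10 (p n : ℕ) (hp : p.Prime) (hn : 1 ≤ n) (Q : Type*) [Quandle Q]
    (hconn : ∀ x y : Q, ∃ g ∈ Dis Q, g x = y)
    (hcard : Nat.card Q = p ^ n) :
    Nat.card (Subgroup.center ↥(Dis Q)) ≠ p ^ (n - 1) := by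
  intro hZc
  have hpn : Nat.card Q ≠ 0 := by rw [hcard]; exact pow_ne_zero _ hp.ne_zero
  have hfin : Finite Q := Nat.finite_of_card_ne_zero hpn
  have hne : Nonempty Q := (Nat.card_ne_zero.1 hpn).1
  obtain ⟨a⟩ := hne
  let H : Subgroup (Equiv.Perm Q) :=
    { carrier := {g | ∀ a, g * QL a * g⁻¹ = QL (g a)}
      one_mem' := by intro a; simp
      mul_mem' := by
        intro g h hg hh a
        rw [Equiv.Perm.mul_apply, ← hg, ← hh]; group
      inv_mem' := by
        intro g hg a
        have := hg (g⁻¹ a)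
        have e : g (g⁻¹ a) = a := Equiv.apply_symm_apply g a
        rw [e] at this
        rw [← this]; group }
  have hLH : ∀ a, QL a ∈ H := fun a b => (QL_conj a b).symm
  have hDH : Dis Q ≤ H := by
    rw [Dis, Subgroup.closure_le]
    rintro _ ⟨a, b, rfl⟩
    exact H.mul_mem (hLH a) (H.inv_mem (hLH b))
  have hHD : ∀ h ∈ H, ∀ g ∈ Dis Q, h * g * h⁻¹ ∈ Dis Q := by
    intro h hh
    have : Dis Q ≤ (Dis Q).comap (MulAut.conj h).toMonoidHom := by
      conv_lhs => rw [Dis]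
      rw [Subgroup.closure_le]
      rintro _ ⟨a, b, rfl⟩
      change h * (QL a * (QL b)⁻¹) * h⁻¹ ∈ Dis Q
      apply Subgroup.subset_closure
      refine ⟨h a, h b, ?_⟩
      rw [← hh a, ← hh b]; group
    exact fun g hg => this hg
  let Z : Subgroup (Equiv.Perm Q) := (Subgroup.center (Dis Q)).map (Dis Q).subtype
  have hZD : Z ≤ Dis Q := by
    rintro _ ⟨z, _, rfl⟩
    exact z.2
  have hZm : ∀ z, z ∈ Z ↔ z ∈ Dis Q ∧ ∀ g ∈ Dis Q, g * z = z * g := by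
    intro z
    constructor
    · rintro ⟨w, hw, rfl⟩
      exact ⟨w.2, fun g hg => congrArg Subtype.val (Subgroup.mem_center_iff.1 hw ⟨g, hg⟩)⟩
    · rintro ⟨h1, h2⟩
      exact ⟨⟨z, h1⟩, Subgroup.mem_center_iff.2 fun g => Subtype.ext (h2 g.1 g.2), rfl⟩
  have hHZ : ∀ h ∈ H, ∀ z ∈ Z, h * z * h⁻¹ ∈ Z := by
    intro h hh z hz
    rw [hZm] at hz ⊢
    refine ⟨hHD h hh z hz.1, fun g hg => ?_⟩
    have h1 := hz.2 (h⁻¹ * g * h) (by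
      have := hHD h⁻¹ (H.inv_mem hh) g hg
      rwa [inv_inv] at this)
    calc g * (h * z * h⁻¹) = h * ((h⁻¹ * g * h) * z) * h⁻¹ := by group
      _ = _ := by rw [h1]; group
  have hZcard : Nat.card Z = p ^ (n - 1) := by
    rw [← hZc]
    exact Subgroup.card_map_of_injective (Subgroup.subtype_injective _)
  have hfree : ∀ x : Q, MulAction.stabilizer Z x = ⊥ := by
    intro x
    rw [eq_bot_iff]
    rintro ⟨z, hz⟩ hzx
    have hzx' : z x = x := hzx
    rw [Subgroup.mem_bot]
    apply Subtype.ext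
    ext y
    obtain ⟨g, hg, rfl⟩ := hconn x y
    have h1 := ((hZm z).1 hz).2 g hg
    change (z * g) x = g x
    rw [← h1, Equiv.Perm.mul_apply, hzx']
  have hB : Nat.card (Quotient (MulAction.orbitRel Z Q)) = p := by
    have h1 := Nat.card_congr (MulAction.selfEquivOrbitsQuotientProd hfree)
    rw [Nat.card_prod, hcard, hZcard] at h1
    obtain ⟨m, rfl⟩ : ∃ m, n = m + 1 := ⟨n - 1, by omega⟩
    rw [Nat.add_sub_cancel, pow_succ'] at h1
    exact (Nat.eq_of_mul_eq_mul_right (pow_pos hp.pos m) h1).symm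
  obtain ⟨π, hπ⟩ := descend H Z hHZ
  have hπZ : ∀ (z : H), z.1 ∈ Z → π z = 1 := by
    intro z hz
    ext x
    induction x using Quotient.inductionOn with
    | h x =>
    rw [hπ]
    exact Quotient.sound ⟨⟨z.1, hz⟩, rfl⟩
  have hπ1 : ∀ (g : H), π g = 1 → ∀ x, ∃ z ∈ Z, g.1 x = z x := by
    intro g hg x
    have h1 := hπ g x
    rw [hg] at h1
    obtain ⟨⟨z, hz⟩, h⟩ := Quotient.exact h1.symm
    exact ⟨z, hz, h.symm⟩
  let LB : Quotient (MulAction.orbitRel Z Q) → Equiv.Perm (Quotient (MulAction.orbitRel Z Q)) :=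
    Quotient.lift (fun x => π ⟨QL x, hLH x⟩) (by
      rintro x y ⟨⟨z, hz⟩, rfl⟩
      have hzH : z ∈ H := hDH (hZD hz)
      have h1 : (⟨QL (z y), hLH (z y)⟩ : H) = ⟨z, hzH⟩ * ⟨QL y, hLH y⟩ * ⟨z, hzH⟩⁻¹ :=
        Subtype.ext (hzH y).symm
      change π ⟨QL (z y), hLH (z y)⟩ = π ⟨QL y, hLH y⟩
      rw [h1, map_mul, map_mul, map_inv, hπZ ⟨z, hzH⟩ hz]
      simp)
  have hLBmk : ∀ x, LB (Quotient.mk _ x) = π ⟨QL x, hLH x⟩ := fun x => rfl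
  have hLB : ∀ x y, LB (LB x y) = LB x * LB y * (LB x)⁻¹ := by
    intro x y
    induction x using Quotient.inductionOn with
    | h x =>
    induction y using Quotient.inductionOn with
    | h y =>
    rw [hLBmk, hπ, hLBmk, hLBmk, ← map_inv, ← map_mul, ← map_mul]
    congr 1
    exact Subtype.ext (QL_conj x y)
  have hin : ∀ g (hg : g ∈ Dis Q), π ⟨g, hDH hg⟩ ∈
      Subgroup.closure {g | ∃ a b, g = LB a * (LB b)⁻¹} := by
    have : Dis Q ≤ ((Subgroup.closure {g | ∃ a b, g = LB a * (LB b)⁻¹}).comap π).map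
        H.subtype := by
      rw [Dis, Subgroup.closure_le]
      rintro _ ⟨a, b, rfl⟩
      refine ⟨⟨QL a, hLH a⟩ * ⟨QL b, hLH b⟩⁻¹, ?_, rfl⟩
      apply Subgroup.subset_closure
      exact ⟨Quotient.mk _ a, Quotient.mk _ b, by rw [map_mul, map_inv, hLBmk, hLBmk]⟩
    intro g hg
    obtain ⟨g', h1, rfl⟩ := this hg
    exact h1
  have hout : Subgroup.closure {g | ∃ a b, g = LB a * (LB b)⁻¹} ≤
      ((Dis Q).subgroupOf H).map π := by
    rw [Subgroup.closure_le]
    rintro _ ⟨x, y, rfl⟩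
    induction x using Quotient.inductionOn with
    | h x =>
    induction y using Quotient.inductionOn with
    | h y =>
    refine ⟨⟨QL x, hLH x⟩ * ⟨QL y, hLH y⟩⁻¹, ?_, by rw [map_mul, map_inv, hLBmk, hLBmk]⟩
    apply Subgroup.subset_closure
    exact ⟨x, y, rfl⟩
  obtain ⟨c, hc, hle⟩ := thmC hp hB LB hLB (by
    intro x y
    induction x using Quotient.inductionOn with
    | h x =>
    induction y using Quotient.inductionOn with
    | h y =>
    obtain ⟨g, hg, rfl⟩ := hconn x y
    exact ⟨_, hin g hg, hπ _ _⟩)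
  obtain ⟨g₀, hg₀, rfl⟩ := hout hc
  have hg₀D : g₀.1 ∈ Dis Q := hg₀
  -- conjugation by `QL a` on the displacement group
  let φ : Dis Q →* Dis Q :=
    { toFun := fun g => ⟨QL a * g.1 * (QL a)⁻¹, hHD _ (hLH a) g.1 g.2⟩
      map_one' := Subtype.ext (by simp)
      map_mul' := fun g h => Subtype.ext (by
        change QL a * (g.1 * h.1) * (QL a)⁻¹ =
          (QL a * g.1 * (QL a)⁻¹) * (QL a * h.1 * (QL a)⁻¹)
        group) }
  have hφ : ∀ g : Dis Q, (φ g).1 = QL a * g.1 * (QL a)⁻¹ := fun g => rfl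
  have hφL : ∀ g : Dis Q, QL (g.1 a) * (QL a)⁻¹ = (g * (φ g)⁻¹).1 := by
    intro g
    change _ = g.1 * (QL a * g.1 * (QL a)⁻¹)⁻¹
    rw [← hDH g.2 a]; group
  have hall := grp_three (G := Dis Q) (Q := Q)
    (fun x y => by
      obtain ⟨g, hg, h⟩ := hconn x y
      exact ⟨⟨g, hg⟩, h⟩) a φ
    (by
      intro g hg
      have hg' : g.1 a = a := hg
      apply Subtype.ext
      have h1 := hDH g.2 a
      rw [hg', mul_inv_eq_iff_eq_mul] at h1
      rw [hφ, ← h1]; group)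
    (by
      rw [eq_top_iff]
      have h1 : Dis Q ≤ (Subgroup.closure {x | ∃ h, x = h * (φ h)⁻¹}).map (Dis Q).subtype := by
        conv_lhs => rw [Dis]
        rw [Subgroup.closure_le]
        have h2 : ∀ x, QL x * (QL a)⁻¹ ∈
            (Subgroup.closure {x | ∃ h, x = h * (φ h)⁻¹}).map (Dis Q).subtype := by
          intro x
          obtain ⟨g, hg, rfl⟩ := hconn a x
          exact ⟨_, Subgroup.subset_closure ⟨⟨g, hg⟩, rfl⟩, (hφL ⟨g, hg⟩).symm⟩
        rintro _ ⟨x, y, rfl⟩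
        have : QL x * (QL y)⁻¹ = (QL x * (QL a)⁻¹) * (QL y * (QL a)⁻¹)⁻¹ := by group
        rw [SetLike.mem_coe, this]
        exact mul_mem (h2 x) (inv_mem (h2 y))
      intro g _
      obtain ⟨g', h3, h4⟩ := h1 g.2
      rwa [← Subtype.ext h4])
    ⟨g₀.1, hg₀D⟩
    (by
      intro g
      obtain ⟨i, hi⟩ := hle (hin g.1 g.2)
      refine ⟨i, fun x => ?_⟩
      have hi' : π g₀ ^ i = π ⟨g.1, hDH g.2⟩ := hi
      obtain ⟨z, hz, h⟩ := hπ1 (⟨g.1, hDH g.2⟩ * (g₀ ^ i)⁻¹) (by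
        rw [map_mul, map_inv, map_zpow, hi', mul_inv_cancel]) x
      obtain ⟨w, hw, rfl⟩ := hz
      exact ⟨w, hw, h⟩)
  have htop : Subgroup.center (Dis Q) = ⊤ := eq_top_iff.2 fun g _ => hall g
  rw [htop, Subgroup.card_top] at hZc
  have hge : Nat.card Q ≤ Nat.card (Dis Q) := by
    refine Nat.card_le_card_of_surjective (fun g : Dis Q => g.1 a) ?_
    intro x
    obtain ⟨g, hg, h⟩ := hconn a x
    exact ⟨⟨g, hg⟩, h⟩
  rw [hcard, hZc] at hge
  have := Nat.pow_lt_pow_right hp.one_lt (show n - 1 < n by omega)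
  omega
end

section
/- Let p be a prime and Q a connected quandle with Nat.card Q = p. Then Q is affine. -/
open Quandles

universe u

/-- A quandle is affine if it is isomorphic to `Aff(A, f)` for some abelian group `A`
and automorphism `f` of `A`. -/
def IsAffine (Q : Type u) [Quandle Q] : Prop :=
  ∃ (A : Type u) (_ : AddCommGroup A) (f : A ≃+ A) (e : Q ≃ A),
    ∀ x y : Q, e (x ◃ y) = e x - f (e x) + f (e y)



theorem aux_diag {d N : ℕ} (hN : 0 < N) (M : Matrix (Fin d) (Fin d) ℂ) (hM : M ^ N = 1) :
    ∃ (v : Fin d → ℂ) (P P' : Matrix (Fin d) (Fin d) ℂ), P * P' = 1 ∧ P' * P = 1 ∧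
      M = P * Matrix.diagonal v * P' ∧ ∀ i, v i ^ N = 1 := by
  classical
  let f : Module.End ℂ (Fin d → ℂ) := Matrix.toLin' M
  have hf : f ^ N = 1 := by
    show (Matrix.toLin' M) ^ N = 1
    rw [← Matrix.toLin'_pow, hM, Matrix.toLin'_one]; rfl
  have hss : f.IsSemisimple := by
    apply Module.End.isSemisimple_of_squarefree_aeval_eq_zero
      (p := (Polynomial.X ^ N - 1 : Polynomial ℂ))
    · have : (Polynomial.X ^ N - Polynomial.C 1 : Polynomial ℂ).Separable :=
        Polynomial.separable_X_pow_sub_C 1 (by exact_mod_cast hN.ne') one_ne_zero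
      simpa using this.squarefree
    · simp [hf]
  have htop : ⨆ μ : ℂ, f.eigenspace μ = ⊤ := hss.iSup_eigenspace_eq_top
  have hhIntl : DirectSum.IsInternal (fun μ : ℂ => f.eigenspace μ) :=
    DirectSum.isInternal_submodule_of_iSupIndep_of_iSup_eq_top f.eigenspaces_iSupIndep htop
  let b := hhIntl.collectedBasis (fun μ => Module.finBasis ℂ (f.eigenspace μ))
  have hfin : Fintype (Σ μ : ℂ, Fin (Module.finrank ℂ (f.eigenspace μ))) :=
    FiniteDimensional.fintypeBasisIndex b
  have hc : Fintype.card (Σ μ : ℂ, Fin (Module.finrank ℂ (f.eigenspace μ))) = d := by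
    rw [← Module.finrank_eq_card_basis b]; simp
  let e := Fintype.equivFinOfCardEq hc
  let b' := b.reindex e
  let v : Fin d → ℂ := fun j => (e.symm j).1
  have hb : ∀ j, f (b' j) = v j • b' j := by
    intro j
    have := hhIntl.collectedBasis_mem (fun μ => Module.finBasis ℂ (f.eigenspace μ)) (e.symm j)
    rw [Module.End.mem_eigenspace_iff] at this
    simpa [b', v, b] using this
  let P : Matrix (Fin d) (Fin d) ℂ := (Pi.basisFun ℂ (Fin d)).toMatrix b'
  let P' : Matrix (Fin d) (Fin d) ℂ := b'.toMatrix (Pi.basisFun ℂ (Fin d))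
  have h1 : P * P' = 1 := Module.Basis.toMatrix_mul_toMatrix_flip _ _
  have h2 : P' * P = 1 := Module.Basis.toMatrix_mul_toMatrix_flip _ _
  have h3 : M * P = P * Matrix.diagonal v := by
    ext i j
    have := congrFun (hb j) i
    simp only [f, Matrix.toLin'_apply, Pi.smul_apply, smul_eq_mul, Matrix.mulVec, dotProduct] at this
    rw [Matrix.mul_diagonal, Matrix.mul_apply]
    simp only [P, Module.Basis.toMatrix_apply, Pi.basisFun_repr]
    rw [this, mul_comm]
  refine ⟨v, P, P', h1, h2, ?_, ?_⟩
  · rw [← h3, mul_assoc, h1, mul_one]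
  · intro j
    have hp : ∀ n : ℕ, (f ^ n) (b' j) = v j ^ n • b' j := by
      intro n
      induction n with
      | zero => simp
      | succ n ih => rw [pow_succ, Module.End.mul_apply, hb, map_smul, ih, smul_smul, pow_succ']
    have := hp N
    rw [hf] at this
    have h0 : (v j ^ N - 1) • b' j = 0 := by
      rw [sub_smul, ← this]; simp
    rcases smul_eq_zero.mp h0 with h | h
    · exact sub_eq_zero.mp h
    · exact absurd h (b'.ne_zero j)

theorem aux_trace_conj {d : ℕ} (v : Fin d → ℂ) (P P' : Matrix (Fin d) (Fin d) ℂ)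
    (h : P' * P = 1) : (P * Matrix.diagonal v * P').trace = ∑ i, v i := by
  rw [Matrix.trace_mul_comm, ← mul_assoc, h, one_mul, Matrix.trace_diagonal]

/-- trace of a finite order matrix is integral -/
theorem aux_trace_int {d N : ℕ} (hN : 0 < N) (M : Matrix (Fin d) (Fin d) ℂ) (hM : M ^ N = 1) :
    IsIntegral ℤ M.trace := by
  obtain ⟨v, P, P', h1, h2, rfl, hv⟩ := aux_diag hN M hM
  rw [aux_trace_conj v P P' h2]
  refine IsIntegral.sum _ fun i _ => ?_
  exact IsIntegral.of_pow hN (by rw [hv]; exact isIntegral_one)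

theorem aux_norm_one {N : ℕ} (hN : 0 < N) {z : ℂ} (h : z ^ N = 1) : ‖z‖ = 1 :=
  Complex.norm_eq_one_of_pow_eq_one h hN.ne'

theorem aux_trace_norm {d N : ℕ} (hN : 0 < N) (M : Matrix (Fin d) (Fin d) ℂ) (hM : M ^ N = 1) :
    ‖M.trace‖ ≤ d := by
  obtain ⟨v, P, P', h1, h2, rfl, hv⟩ := aux_diag hN M hM
  rw [aux_trace_conj v P P' h2]
  refine (norm_sum_le _ _).trans ?_
  simp [fun i => aux_norm_one hN (hv i)]

theorem aux_trace_inv {d N : ℕ} (hN : 0 < N) (M M' : Matrix (Fin d) (Fin d) ℂ) (hM : M ^ N = 1)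
    (hMM : M * M' = 1) : M'.trace = star M.trace := by
  obtain ⟨v, P, P', h1, h2, rfl, hv⟩ := aux_diag hN M hM
  have hvv : ∀ i, v i * star (v i) = 1 := by
    intro i
    have := Complex.mul_conj (v i)
    rw [Complex.normSq_eq_norm_sq, aux_norm_one hN (hv i)] at this
    simpa using this
  have : M' = P * Matrix.diagonal (fun i => star (v i)) * P' := by
    have h3 : (P * Matrix.diagonal (fun i => star (v i)) * P') * (P * Matrix.diagonal v * P') = 1 := by
      calc _ = P * Matrix.diagonal (fun i => star (v i)) * (P' * P) * Matrix.diagonal v * P' := by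
            simp only [mul_assoc]
        _ = 1 := by
          rw [h2, mul_one, mul_assoc P, Matrix.diagonal_mul_diagonal]
          simp only [mul_comm (star (v _)), hvv]
          simp [h1]
    exact (left_inv_eq_right_inv h3 hMM).symm
  rw [this, aux_trace_conj _ P P' h2, aux_trace_conj _ P P' h2, star_sum]

/-- equality case -/
theorem aux_trace_eq {d N : ℕ} (hd : 0 < d) (hN : 0 < N) (M : Matrix (Fin d) (Fin d) ℂ)
    (hM : M ^ N = 1) (h : (d : ℝ) ≤ ‖M.trace‖) : ∃ c : ℂ, M = Matrix.scalar (Fin d) c := by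
  obtain ⟨v, P, P', h1, h2, rfl, hv⟩ := aux_diag hN M hM
  rw [aux_trace_conj v P P' h2] at h
  set s := ∑ i, v i with hs
  have hs0 : s ≠ 0 := by
    intro h0; rw [h0, norm_zero] at h
    have : (0 : ℝ) < d := by exact_mod_cast hd
    linarith
  let c : ℂ := s / ‖s‖
  have hn0 : (‖s‖ : ℂ) ≠ 0 := by simpa using hs0
  have hcn : ‖c‖ = 1 := by simp [c, hs0]
  have hcc : star c * c = 1 := by
    have := Complex.mul_conj c
    rw [Complex.normSq_eq_norm_sq, hcn] at this
    rw [mul_comm]; simpa using this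
  have hw : ∀ i, ‖star c * v i‖ = 1 := by
    intro i; rw [norm_mul, norm_star, hcn, aux_norm_one hN (hv i), one_mul]
  have hsum : ∑ i, (star c * v i).re = ‖s‖ := by
    rw [← Complex.re_sum, ← Finset.mul_sum, ← hs]
    have : s = c * ‖s‖ := by simp only [c]; field_simp
    have h5 : star c * s = (‖s‖ : ℂ) := by
      calc star c * s = star c * (c * ‖s‖) := by rw [← this]
        _ = _ := by rw [← mul_assoc, hcc, one_mul]
    rw [h5, Complex.ofReal_re]
  have hle : ∀ i ∈ Finset.univ, (star c * v i).re ≤ 1 := fun i _ =>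
    (Complex.re_le_norm _).trans (hw i).le
  have heq : ∑ i, (star c * v i).re = ∑ i : Fin d, (1 : ℝ) := by
    apply le_antisymm (Finset.sum_le_sum hle)
    rw [hsum]; simpa using h
  have hre := (Finset.sum_eq_sum_iff_of_le hle).mp heq
  have hvc : ∀ i, v i = c := by
    intro i
    have h6 := hre i (Finset.mem_univ i)
    have h7 : (star c * v i) = 1 := by
      have h8 := hw i
      have h9 : Complex.normSq (star c * v i) = 1 := by rw [Complex.normSq_eq_norm_sq, h8]; norm_num
      rw [Complex.normSq_apply, h6] at h9
      apply Complex.ext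
      · simpa using h6
      · simpa using h9
    calc v i = (star c * c) * v i := by rw [hcc, one_mul]
      _ = c * (star c * v i) := by ring
      _ = c := by rw [h7, mul_one]
  refine ⟨c, ?_⟩
  have : Matrix.diagonal v = Matrix.scalar (Fin d) c := by
    ext i j; simp [Matrix.diagonal, hvc]
  rw [this, ← (Matrix.scalar_commute c (fun r' => mul_comm _ _) P).eq, mul_assoc, h1, mul_one]

theorem aux_trace_pi {n : ℕ} (d : Fin n → ℕ)
    (a b : Π i, Matrix (Fin (d i)) (Fin (d i)) ℂ) :
    LinearMap.trace ℂ (Π i, Matrix (Fin (d i)) (Fin (d i)) ℂ)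
      (LinearMap.mulLeft ℂ a ∘ₗ LinearMap.mulRight ℂ b) =
      ∑ i, (a i).trace * (b i).trace := by
  classical
  let B := Pi.basis (fun i => Matrix.stdBasis ℂ (Fin (d i)) (Fin (d i)))
  rw [LinearMap.trace_eq_matrix_trace ℂ B, Matrix.trace, Fintype.sum_sigma]
  refine Finset.sum_congr rfl fun i _ => ?_
  rw [Fintype.sum_prod_type, Matrix.trace, Matrix.trace, Finset.sum_mul_sum]
  refine Finset.sum_congr rfl fun j _ => Finset.sum_congr rfl fun k _ => ?_
  rw [Matrix.diag_apply, LinearMap.toMatrix_apply]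
  simp only [B, Pi.basis_repr, Pi.basis_apply, Matrix.stdBasis_eq_single]
  have : ((LinearMap.mulLeft ℂ a ∘ₗ LinearMap.mulRight ℂ b)
     (Pi.single i (Matrix.single j k 1))) i = a i * (Matrix.single j k 1 * b i) := by
    simp
  rw [this]
  have h2 : ∀ X : Matrix (Fin (d i)) (Fin (d i)) ℂ,
    (Matrix.stdBasis ℂ (Fin (d i)) (Fin (d i))).repr X (j, k) = X j k := by
    intro X; simp [Matrix.stdBasis]
  rw [h2, ← mul_assoc]
  rw [Matrix.mul_apply, Finset.sum_eq_single k]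
  · simp
  · intro l _ hl
    rw [Matrix.mul_single_apply_of_ne (hbj := hl), zero_mul]
  · simp

theorem aux_trace_alg {G : Type*} [Group G] [Fintype G] [DecidableEq G] (g h : G) :
    LinearMap.trace ℂ (MonoidAlgebra ℂ G)
      (LinearMap.mulLeft ℂ (MonoidAlgebra.single g 1) ∘ₗ
        LinearMap.mulRight ℂ (MonoidAlgebra.single h 1)) =
      ((Finset.univ.filter fun x : G => g * x * h = x).card : ℂ) := by
  classical
  rw [LinearMap.trace_eq_matrix_trace ℂ (MonoidAlgebra.basis G ℂ), Matrix.trace,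
    Finset.card_filter, Nat.cast_sum]
  refine Finset.sum_congr rfl fun x _ => ?_
  rw [Matrix.diag_apply, LinearMap.toMatrix_apply]
  simp [MonoidAlgebra.basis, MonoidAlgebra.single_mul_single, Finsupp.single_apply, mul_assoc]

theorem aux_wedderburn (G : Type*) [Group G] [Fintype G] [DecidableEq G] :
    ∃ (n : ℕ) (d : Fin n → ℕ) (_ : ∀ i, 0 < d i)
      (ρ : ∀ i, G →* Matrix (Fin (d i)) (Fin (d i)) ℂ),
      (∀ i M, (∀ g, ρ i g * M = M * ρ i g) → ∃ c, M = Matrix.scalar (Fin (d i)) c) ∧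
      (∀ g h, ∑ i, (ρ i g).trace * (ρ i h).trace =
        ((Finset.univ.filter fun x : G => g * x * h = x).card : ℂ)) := by
  classical
  have : Module.Finite ℂ (MonoidAlgebra ℂ G) := Module.Finite.of_basis (MonoidAlgebra.basis G ℂ)
  have : NeZero (Nat.card G : ℂ) := ⟨by simp⟩
  obtain ⟨n, d, hd, ⟨φ⟩⟩ := IsSemisimpleRing.exists_algEquiv_pi_matrix_of_isAlgClosed ℂ
    (MonoidAlgebra ℂ G)
  let R : ∀ i, MonoidAlgebra ℂ G →ₐ[ℂ] Matrix (Fin (d i)) (Fin (d i)) ℂ := fun i =>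
    (Pi.evalAlgHom ℂ (fun i => Matrix (Fin (d i)) (Fin (d i)) ℂ) i).comp φ.toAlgHom
  refine ⟨n, d, fun i => Nat.pos_of_ne_zero (hd i).out,
    fun i => (R i : MonoidAlgebra ℂ G →* _).comp (MonoidAlgebra.of ℂ G), ?_, ?_⟩
  · intro i M hM
    have hall : ∀ x : MonoidAlgebra ℂ G, R i x * M = M * R i x := by
      intro x
      induction x using MonoidAlgebra.induction_on with
      | of g => exact hM g
      | add f g hf hg => simp [add_mul, mul_add, hf, hg]
      | smul r f hf => simp [hf]
    have hsurj : Function.Surjective (R i) := by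
      intro X
      obtain ⟨x, hx⟩ := φ.surjective (Pi.single i X)
      exact ⟨x, by simp [R, hx]⟩
    have : M ∈ Set.range (Matrix.scalar (Fin (d i))) := by
      rw [Matrix.mem_range_scalar_iff_commute_single]
      intro j k _
      obtain ⟨x, hx⟩ := hsurj (Matrix.single j k 1)
      rw [← hx]; exact hall x
    obtain ⟨c, hc⟩ := this
    exact ⟨c, hc.symm⟩
  · intro g h
    rw [← aux_trace_alg, ← LinearMap.trace_conj' _ φ.toLinearEquiv]
    refine (aux_trace_pi d (φ (MonoidAlgebra.single g 1)) (φ (MonoidAlgebra.single h 1))).symm.trans ?_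
    congr 1
    refine LinearMap.ext fun x => ?_
    simp [LinearEquiv.conj_apply]

theorem aux_class {G : Type*} [Group G] [Fintype G] [DecidableEq G] (y : G) :
    (Finset.univ.filter fun c : G => IsConj y c).card *
      (Finset.univ.filter fun x : G => y * x * y⁻¹ = x).card = Fintype.card G := by
  classical
  have := Finset.card_eq_sum_card_fiberwise (s := (Finset.univ : Finset G))
    (t := Finset.univ.filter fun c : G => IsConj y c) (f := fun g => g * y * g⁻¹)
    (by intro g _; simp [isConj_iff])
  rw [← Finset.card_univ, this, Finset.sum_const_nat]
  intro c hc
  simp only [Finset.mem_filter, Finset.mem_univ, true_and, isConj_iff] at hc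
  obtain ⟨g, rfl⟩ := hc
  symm
  apply Finset.card_bij (fun x _ => g * x)
  · intro x hx
    simp only [Finset.mem_filter, Finset.mem_univ, true_and] at hx ⊢
    have : x * y * x⁻¹ = y := by
      rw [mul_inv_eq_iff_eq_mul] at hx ⊢; exact hx.symm
    calc g * x * y * (g * x)⁻¹ = g * (x * y * x⁻¹) * g⁻¹ := by group
      _ = _ := by rw [this]
  · intro a _ b _ h; exact mul_left_cancel h
  · intro b hb
    simp only [Finset.mem_filter, Finset.mem_univ, true_and] at hb
    refine ⟨g⁻¹ * b, ?_, by group⟩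
    simp only [Finset.mem_filter, Finset.mem_univ, true_and]
    rw [mul_inv_eq_iff_eq_mul]
    have : b * y = g * y * g⁻¹ * b := by rw [← hb]; group
    calc y * (g⁻¹ * b) = g⁻¹ * (g * y * g⁻¹ * b) := by group
      _ = g⁻¹ * (b * y) := by rw [this]
      _ = _ := by group

/-- class sum -/
noncomputable def auxCls {G : Type*} [Group G] [Fintype G] [DecidableEq G] (z : G) :
    MonoidAlgebra ℤ G :=
  ∑ c ∈ Finset.univ.filter (fun c : G => IsConj z c), MonoidAlgebra.single c 1

theorem aux_fin_int {G : Type*} [Group G] [Fintype G] (x : MonoidAlgebra ℤ G) : IsIntegral ℤ x := by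
  have : Module.Finite ℤ (MonoidAlgebra ℤ G) := Module.Finite.of_basis (MonoidAlgebra.basis G ℤ)
  exact Algebra.IsIntegral.isIntegral x

theorem aux_cls {G : Type*} [Group G] [Fintype G] [DecidableEq G] {d : ℕ} (hd : 0 < d)
    (ρ : G →* Matrix (Fin d) (Fin d) ℂ)
    (hS : ∀ M, (∀ g, ρ g * M = M * ρ g) → ∃ c, M = Matrix.scalar (Fin d) c) (z : G) :
    ∃ ω : ℂ, IsIntegral ℤ ω ∧
      MonoidAlgebra.lift ℤ (Matrix (Fin d) (Fin d) ℂ) G ρ (auxCls z) = Matrix.scalar (Fin d) ω ∧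
      d * ω = ((Finset.univ.filter fun c : G => IsConj z c).card : ℂ) * (ρ z).trace := by
  have hE : MonoidAlgebra.lift ℤ (Matrix (Fin d) (Fin d) ℂ) G ρ (auxCls z) =
      ∑ c ∈ Finset.univ.filter (fun c : G => IsConj z c), ρ c := by
    simp [auxCls]
  obtain ⟨ω, hω⟩ := hS (MonoidAlgebra.lift ℤ (Matrix (Fin d) (Fin d) ℂ) G ρ (auxCls z)) (by
    intro g
    rw [hE, Finset.mul_sum, Finset.sum_mul]
    apply Finset.sum_bij (fun c _ => g * c * g⁻¹)
    · intro c hc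
      simp only [Finset.mem_filter, Finset.mem_univ, true_and] at hc ⊢
      exact hc.trans (isConj_iff.mpr ⟨g, rfl⟩)
    · intro a _ b _ h; simpa using h
    · intro b hb
      simp only [Finset.mem_filter, Finset.mem_univ, true_and] at hb
      refine ⟨g⁻¹ * b * g, ?_, by group⟩
      simp only [Finset.mem_filter, Finset.mem_univ, true_and]
      exact hb.trans (isConj_iff.mpr ⟨g⁻¹, by group⟩)
    · intro c _
      rw [← map_mul, ← map_mul]; congr 1; group)
  refine ⟨ω, ?_, hω, ?_⟩
  · have h1 := (aux_fin_int (auxCls z)).map (MonoidAlgebra.lift ℤ (Matrix (Fin d) (Fin d) ℂ) G ρ)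
    rw [hω] at h1
    have : Nonempty (Fin d) := ⟨⟨0, hd⟩⟩
    have h2 : Matrix.scalar (Fin d) ω = algebraMap ℂ (Matrix (Fin d) (Fin d) ℂ) ω := by
      ext i j; simp [Matrix.algebraMap_matrix_apply, Matrix.diagonal_apply]
    rw [h2] at h1
    exact (isIntegral_algebraMap_iff (FaithfulSMul.algebraMap_injective ℂ _)).mp h1
  · have h1 : (Matrix.scalar (Fin d) ω).trace = d * ω := by simp [Matrix.trace]
    rw [← h1, ← hω, hE, Matrix.trace_sum, Finset.sum_congr rfl (g := fun _ => (ρ z).trace)]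
    · simp
    · intro c hc
      simp only [Finset.mem_filter, Finset.mem_univ, true_and, isConj_iff] at hc
      obtain ⟨g, rfl⟩ := hc
      rw [map_mul, Matrix.trace_mul_comm, ← map_mul]
      congr 2; group

theorem aux_rat_int (a b : ℤ) (h : IsIntegral ℤ ((a : ℂ) / b)) : ∃ k : ℤ, (a : ℂ) / b = k := by
  have h1 : ((a : ℂ) / b) = algebraMap ℚ ℂ ((a : ℚ) / b) := by simp
  rw [h1, isIntegral_algebraMap_iff (FaithfulSMul.algebraMap_injective ℚ ℂ)] at h
  obtain ⟨k, hk⟩ := IsIntegrallyClosed.isIntegral_iff.mp h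
  refine ⟨k, ?_⟩
  rw [h1, ← hk]; simp

theorem aux_ratl {d p : ℕ} (hp : 0 < p) (M : Matrix (Fin d) (Fin d) ℂ) (hM : M ^ p = 1) :
    ∃ t : ℕ, ∑ j ∈ Finset.range p, (M ^ j).trace * star (M ^ j).trace = t := by
  classical
  obtain ⟨v, P, P', h1, h2, rfl, hv⟩ := aux_diag hp M hM
  have hpow : ∀ j : ℕ, (P * Matrix.diagonal v * P') ^ j =
      P * Matrix.diagonal (fun i => v i ^ j) * P' := by
    intro j
    induction j with
    | zero => simp [h1]
    | succ j ih =>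
      rw [pow_succ, ih]
      calc _ = P * Matrix.diagonal (fun i => v i ^ j) * (P' * P) * Matrix.diagonal v * P' := by
            simp only [mul_assoc]
        _ = _ := by
          rw [h2, mul_one, mul_assoc P, Matrix.diagonal_mul_diagonal]
          simp [pow_succ]
  have hvv : ∀ i, v i * star (v i) = 1 := by
    intro i
    have := Complex.mul_conj (v i)
    rw [Complex.normSq_eq_norm_sq, aux_norm_one hp (hv i)] at this
    simpa using this
  refine ⟨∑ k : Fin d, ∑ l : Fin d, if v k * star (v l) = 1 then p else 0, ?_⟩
  simp only [hpow, aux_trace_conj _ P P' h2, star_sum, Finset.sum_mul_sum]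
  rw [Finset.sum_comm]
  push_cast
  refine Finset.sum_congr rfl fun k _ => ?_
  rw [Finset.sum_comm]
  refine Finset.sum_congr rfl fun l _ => ?_
  simp only [star_pow, ← mul_pow]
  split_ifs with h
  · simp only [h, one_pow]; simp
  · have h5 : (v k * star (v l)) ^ p = 1 := by rw [mul_pow, ← star_pow, hv, hv]; simp
    have := mul_neg_geom_sum (v k * star (v l)) p
    rw [h5, sub_self] at this
    rcases mul_eq_zero.mp this with h6 | h6
    · exact absurd (sub_eq_zero.mp h6).symm h
    · simpa using h6

/-- trace of the sum over a subgroup -/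
theorem aux_subgroup_trace {G : Type*} [Group G] [Fintype G] {d : ℕ}
    (ρ : G →* Matrix (Fin d) (Fin d) ℂ) (D : Subgroup G) [Fintype D] :
    ∃ t : ℕ, (∑ g : D, ρ g).trace = t := by
  classical
  set E := ∑ g : D, ρ g with hE
  have hgE : ∀ h : D, ρ h * E = E := by
    intro h
    rw [hE, Finset.mul_sum]
    refine Fintype.sum_equiv (Equiv.mulLeft h) _ _ fun g => ?_
    simp
  have hEE : E * E = (Fintype.card D : ℂ) • E := by
    conv_lhs => rw [hE, Finset.sum_mul]
    rw [Finset.sum_congr rfl (fun h _ => hgE h)]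
    simp [Nat.cast_smul_eq_nsmul]
  have hc : (Fintype.card D : ℂ) ≠ 0 := by simp
  let F := (Fintype.card D : ℂ)⁻¹ • E
  have hF : F * F = F := by
    simp only [F, smul_mul_smul_comm, hEE, smul_smul]
    congr 1; field_simp
  have hid : IsIdempotentElem (Matrix.toLin' F) := by
    show Matrix.toLin' F * Matrix.toLin' F = Matrix.toLin' F
    rw [Module.End.mul_eq_comp, ← Matrix.toLin'_mul, hF]
  have ht := (LinearMap.IsIdempotentElem.isProj_range _ hid).trace
  rw [Matrix.trace_toLin'_eq] at ht
  refine ⟨Fintype.card D * Module.finrank ℂ (LinearMap.range (Matrix.toLin' F)), ?_⟩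
  have : E = (Fintype.card D : ℂ) • F := by simp [F, smul_smul, hc]
  rw [this, Matrix.trace_smul, ht]; simp

/-- defect zero characters vanish on elements of order `p` -/
theorem aux_defect {G : Type*} [Group G] [Fintype G] [DecidableEq G] {n : ℕ} {d : Fin n → ℕ}
    (hd : ∀ i, 0 < d i) (ρ : ∀ i, G →* Matrix (Fin (d i)) (Fin (d i)) ℂ)
    (hS : ∀ i M, (∀ g, ρ i g * M = M * ρ i g) → ∃ c, M = Matrix.scalar (Fin (d i)) c)
    (hC : ∀ g h, ∑ i, (ρ i g).trace * (ρ i h).trace =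
        ((Finset.univ.filter fun x : G => g * x * h = x).card : ℂ))
    {p m : ℕ} (hp : p.Prime) (hG : Fintype.card G = p * m) (hpm : ¬ p ∣ m)
    (hcen : ∀ w : G, orderOf w = p → (Finset.univ.filter fun x : G => w * x * w⁻¹ = x).card = p)
    (y : G) (hy : orderOf y = p) (i : Fin n) (hi : p ∣ d i) : (ρ i y).trace = 0 := by
  have hN : 0 < Fintype.card G := Fintype.card_pos
  have hpow : ∀ i g, ρ i g ^ Fintype.card G = 1 := by
    intro i g; rw [← map_pow, pow_card_eq_one, map_one]
  have hinv : ∀ i g, (ρ i g⁻¹).trace = star (ρ i g).trace := by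
    intro i g
    exact aux_trace_inv hN _ _ (hpow i g) (by rw [← map_mul, mul_inv_cancel, map_one])
  have hp0 : (p : ℂ) ≠ 0 := by exact_mod_cast hp.ne_zero
  have hcop : IsCoprime (p : ℤ) (m : ℤ) :=
    Nat.isCoprime_iff_coprime.mpr ((Nat.Prime.coprime_iff_not_dvd hp).mpr hpm)
  have key : ∀ w : G, orderOf w = p → IsIntegral ℤ ((ρ i w).trace / p) := by
    intro w hw
    obtain ⟨ω, hω, -, hω2⟩ := aux_cls (hd i) (ρ i) (hS i) w
    have hcl := aux_class w
    rw [hcen w hw, hG, mul_comm] at hcl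
    have hcl' := Nat.eq_of_mul_eq_mul_left hp.pos hcl
    rw [hcl'] at hω2
    obtain ⟨e, he⟩ := hi
    obtain ⟨u, v, huv⟩ := hcop
    have huv' : (u : ℂ) * p + v * m = 1 := by exact_mod_cast huv
    have he' : (d i : ℂ) = p * e := by exact_mod_cast he
    rw [he'] at hω2
    have : (ρ i w).trace / p = u * (ρ i w).trace + v * (e * ω) := by
      rw [div_eq_iff hp0]
      calc (ρ i w).trace = (u * p + v * m) * (ρ i w).trace := by rw [huv', one_mul]
        _ = u * p * (ρ i w).trace + v * (m * (ρ i w).trace) := by ring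
        _ = _ := by rw [← hω2]; ring
    rw [this]
    have hu : IsIntegral ℤ (u : ℂ) := isIntegral_algebraMap (R := ℤ) (x := u)
    have hv : IsIntegral ℤ (v : ℂ) := isIntegral_algebraMap (R := ℤ) (x := v)
    have he : IsIntegral ℤ (e : ℂ) := by exact_mod_cast isIntegral_algebraMap (R := ℤ) (A := ℂ) (x := (e : ℤ))
    exact (hu.mul (aux_trace_int hN _ (hpow i w))).add (hv.mul (he.mul hω))
  have hyj : ∀ j ∈ Finset.Ico 1 p, orderOf (y ^ j) = p := by
    intro j hj
    rw [Finset.mem_Ico] at hj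
    have : Nat.Coprime p j :=
      (Nat.Prime.coprime_iff_not_dvd hp).mpr (Nat.not_dvd_of_pos_of_lt hj.1 hj.2)
    rw [Nat.Coprime.orderOf_pow (by rw [hy]; exact this), hy]
  set S : ℝ := ∑ j ∈ Finset.Ico 1 p, ‖(ρ i (y ^ j)).trace‖ ^ 2 with hSdef
  have hsq : ∀ x : ℂ, x * star x = ((‖x‖ ^ 2 : ℝ) : ℂ) := by
    intro x
    have := Complex.mul_conj x
    rw [Complex.normSq_eq_norm_sq] at this
    exact this
  have hSle : S ≤ p * (p - 1) := by
    have h1 : ∀ j ∈ Finset.Ico 1 p, ‖(ρ i (y ^ j)).trace‖ ^ 2 ≤ p := by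
      intro j hj
      have h2 := hC (y ^ j) (y ^ j)⁻¹
      rw [hcen _ (hyj j hj)] at h2
      simp only [hinv, hsq] at h2
      have h3 : ∑ i, ‖(ρ i (y ^ j)).trace‖ ^ 2 = (p : ℝ) := by exact_mod_cast h2
      rw [← h3]
      exact Finset.single_le_sum (f := fun i => ‖(ρ i (y ^ j)).trace‖ ^ 2)
        (fun i _ => by positivity) (Finset.mem_univ i)
    refine (Finset.sum_le_sum h1).trans ?_
    rw [Finset.sum_const, Nat.card_Ico, nsmul_eq_mul, Nat.cast_sub hp.one_le]
    push_cast; linarith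
  have hSint : IsIntegral ℤ ((S : ℂ) / (p ^ 2 : ℂ)) := by
    have : (S : ℂ) / (p ^ 2 : ℂ) = ∑ j ∈ Finset.Ico 1 p,
        ((ρ i (y ^ j)).trace / p) * ((ρ i (y ^ j)⁻¹).trace / p) := by
      rw [hSdef, Complex.ofReal_sum, Finset.sum_div]
      refine Finset.sum_congr rfl fun j _ => ?_
      rw [hinv, ← hsq]; field_simp
    rw [this]
    refine IsIntegral.sum _ fun j hj => ?_
    exact (key _ (hyj j hj)).mul (key _ (by rw [orderOf_inv, hyj j hj]))
  obtain ⟨t, ht⟩ := aux_ratl hp.pos (ρ i y) (by rw [← map_pow, ← hy, pow_orderOf_eq_one, map_one])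
  have hSt : (S : ℂ) = ((t - (d i) ^ 2 : ℤ) : ℂ) := by
    rw [Finset.range_eq_Ico, Finset.sum_eq_sum_Ico_succ_bot hp.pos] at ht
    simp only [hsq, ← map_pow] at ht
    have h3 : (ρ i (y ^ 0)).trace = d i := by simp
    rw [h3, ← Complex.ofReal_sum, zero_add, ← hSdef] at ht
    push_cast
    rw [← ht]
    simp
  have hp2 : (p ^ 2 : ℂ) = ((p ^ 2 : ℤ) : ℂ) := by push_cast; rfl
  rw [hSt, hp2] at hSint
  obtain ⟨k, hk⟩ := aux_rat_int _ _ hSint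
  rw [← hSt, ← hp2] at hk
  have hkR : S / (p : ℝ) ^ 2 = k := by exact_mod_cast hk
  have hpR : (0 : ℝ) < p := by exact_mod_cast hp.pos
  have hS0 : 0 ≤ S := Finset.sum_nonneg fun j _ => by positivity
  have hk0 : k = 0 := by
    have h1 : (0 : ℝ) ≤ k := by rw [← hkR]; positivity
    have h2 : (k : ℝ) < 1 := by
      rw [← hkR, div_lt_one (by positivity)]; nlinarith
    have h1' : 0 ≤ k := by exact_mod_cast h1
    have h2' : k < 1 := by exact_mod_cast h2
    omega
  rw [hk0] at hkR
  have hSz : S = 0 := by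
    rw [div_eq_iff (by positivity)] at hkR; simpa using hkR
  have := (Finset.sum_eq_zero_iff_of_nonneg (fun j _ => by positivity)).mp hSz 1
    (by rw [Finset.mem_Ico]; exact ⟨le_rfl, hp.one_lt⟩)
  simpa using this

theorem aux_coeff {G : Type*} [Group G] [Fintype G] [DecidableEq G] {n : ℕ} {d : Fin n → ℕ}
    (ρ : ∀ i, G →* Matrix (Fin (d i)) (Fin (d i)) ℂ)
    (hC : ∀ g h, ∑ i, (ρ i g).trace * (ρ i h).trace =
        ((Finset.univ.filter fun x : G => g * x * h = x).card : ℂ)) (x : MonoidAlgebra ℤ G) :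
    ∑ i, (d i : ℂ) * (MonoidAlgebra.lift ℤ (Matrix (Fin (d i)) (Fin (d i)) ℂ) G (ρ i) x).trace
      = Fintype.card G * (x.coeff 1 : ℤ) := by
  induction x using MonoidAlgebra.induction_on with
  | of g =>
    have := hC g 1
    simp only [map_one, Matrix.trace_one, Fintype.card_fin] at this
    simp only [MonoidAlgebra.lift_of]
    simp only [mul_comm ((d _ : ℂ))]
    rw [this]
    by_cases hg : g = 1
    · subst hg; simp [MonoidAlgebra.of_apply]
    · simp [MonoidAlgebra.of_apply, hg, Finsupp.single_apply]
  | add f g hf hg =>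
    simp only [map_add, Matrix.trace_add, mul_add, Finset.sum_add_distrib, hf, hg]
    simp [mul_add]
  | smul r f hf =>
    simp only [map_smul, Matrix.trace_smul, mul_smul_comm, ← Finset.smul_sum, hf]
    rw [MonoidAlgebra.coeff_smul, Finsupp.smul_apply, smul_eq_mul, zsmul_eq_mul]
    push_cast; ring

theorem aux_main {G : Type*} [Group G] [Fintype G] [DecidableEq G]
    {p m : ℕ} (hp : p.Prime) (hG : Fintype.card G = p * m) (hpm : ¬ p ∣ m)
    (hcen : ∀ w : G, orderOf w = p → (Finset.univ.filter fun x : G => w * x * w⁻¹ = x).card = p)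
    (y z : G) (hy : orderOf y = p)
    (hz : (Finset.univ.filter fun c : G => IsConj z c).card = p)
    (D : Subgroup G) (hyD : y ∈ D)
    (hD : D ≤ Subgroup.closure {g | ∃ a b, IsConj z a ∧ IsConj z b ∧ g = a * b⁻¹}) :
    Nat.card D ≤ p := by
  classical
  obtain ⟨n, d, hd, ρ, hS, hC⟩ := aux_wedderburn G
  have hN : 0 < Fintype.card G := Fintype.card_pos
  have hpow : ∀ i g, ρ i g ^ Fintype.card G = 1 := by
    intro i g; rw [← map_pow, pow_card_eq_one, map_one]
  have hp0 : (p : ℂ) ≠ 0 := by exact_mod_cast hp.ne_zero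
  have hd0 : ∀ i, (d i : ℂ) ≠ 0 := fun i => by exact_mod_cast (hd i).ne'
  have hz' : (Finset.univ.filter fun c : G => IsConj z⁻¹ c).card = p := by
    rw [← hz]
    refine Finset.card_bij (fun x _ => x⁻¹) ?_ ?_ ?_
    · intro a ha
      simp only [Finset.mem_filter, Finset.mem_univ, true_and, isConj_iff] at ha ⊢
      obtain ⟨c, rfl⟩ := ha
      exact ⟨c, by group⟩
    · intro a _ b _ h; simpa using h
    · intro a ha
      simp only [Finset.mem_filter, Finset.mem_univ, true_and, isConj_iff] at ha
      obtain ⟨c, rfl⟩ := ha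
      refine ⟨(c * z * c⁻¹)⁻¹, ?_, by group⟩
      simp only [Finset.mem_filter, Finset.mem_univ, true_and, isConj_iff]
      exact ⟨c, by group⟩
  choose ω hωi hωl hωt using fun i => aux_cls (hd i) (ρ i) (hS i) z
  choose ω' hωi' hωl' hωt' using fun i => aux_cls (hd i) (ρ i) (hS i) z⁻¹
  rw [hz] at hωt
  rw [hz'] at hωt'
  let α : Fin n → ℂ := fun i => (ρ i z).trace / d i
  let α' : Fin n → ℂ := fun i => (ρ i z⁻¹).trace / d i
  have hωα : ∀ i, ω i = p * α i := by
    intro i; simp only [α]; have := hωt i; have := hd0 i; field_simp; linear_combination hωt i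
  have hωα' : ∀ i, ω' i = p * α' i := by
    intro i; simp only [α']; have := hωt' i; have := hd0 i; field_simp; linear_combination hωt' i
  have hhIntl : ∀ i, ¬ p ∣ d i → ∀ (w : G) (o : ℂ), IsIntegral ℤ o → d i * o = p * (ρ i w).trace →
      IsIntegral ℤ ((ρ i w).trace / d i) := by
    intro i hi w o ho hot
    obtain ⟨u, v, huv⟩ : IsCoprime (p : ℤ) (d i : ℤ) :=
      Nat.isCoprime_iff_coprime.mpr ((Nat.Prime.coprime_iff_not_dvd hp).mpr hi)
    have huv' : (u : ℂ) * p + v * d i = 1 := by exact_mod_cast huv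
    have : (ρ i w).trace / d i = u * o + v * (ρ i w).trace := by
      rw [div_eq_iff (hd0 i)]
      calc (ρ i w).trace = (u * p + v * d i) * (ρ i w).trace := by rw [huv', one_mul]
        _ = u * (p * (ρ i w).trace) + v * d i * (ρ i w).trace := by ring
        _ = _ := by rw [← hot]; ring
    rw [this]
    have hu : IsIntegral ℤ (u : ℂ) := isIntegral_algebraMap (R := ℤ) (x := u)
    have hv : IsIntegral ℤ (v : ℂ) := isIntegral_algebraMap (R := ℤ) (x := v)
    exact (hu.mul ho).add (hv.mul (aux_trace_int hN _ (hpow i w)))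
  let U : ℕ → ℂ := fun k => ∑ i, d i * (α i * α' i) ^ k * (ρ i y).trace
  have hUint : ∀ k, IsIntegral ℤ (U k) := by
    intro k
    refine IsIntegral.sum _ fun i _ => ?_
    by_cases hi : p ∣ d i
    · rw [aux_defect hd ρ hS hC hp hG hpm hcen y hy i hi, mul_zero]; exact isIntegral_zero
    · have he : IsIntegral ℤ (d i : ℂ) := by
        exact_mod_cast isIntegral_algebraMap (R := ℤ) (A := ℂ) (x := (d i : ℤ))
      exact (he.mul (((hhIntl i hi z _ (hωi i) (hωt i)).mul
        (hhIntl i hi z⁻¹ _ (hωi' i) (hωt' i))).pow k)).mul (aux_trace_int hN _ (hpow i y))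
  have hUN : ∀ k, ∃ N : ℤ, U k * (p : ℂ) ^ (2 * k) = (Fintype.card G : ℂ) * N := by
    intro k
    have h := aux_coeff ρ hC ((auxCls z * auxCls z⁻¹) ^ k * MonoidAlgebra.of ℤ G y)
    refine ⟨_, Eq.trans ?_ h⟩
    simp only [U, Finset.sum_mul]
    refine Finset.sum_congr rfl fun i _ => ?_
    rw [map_mul, map_pow, map_mul, hωl, hωl', MonoidAlgebra.lift_of, ← map_mul, ← map_pow]
    have : (Matrix.scalar (Fin (d i)) ((ω i * ω' i) ^ k) * ρ i y).trace =
        (ω i * ω' i) ^ k * (ρ i y).trace := by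
      simp [Matrix.scalar_apply, ← Matrix.smul_eq_diagonal_mul]
    rw [this, hωα, hωα', mul_mul_mul_comm, mul_pow, pow_mul, sq]; ring
  have hUZ : ∀ k, ∃ t : ℤ, U k = t := by
    intro k
    obtain ⟨N, hN'⟩ := hUN k
    have h1 : U k = (((Fintype.card G : ℤ) * N : ℤ) : ℂ) / ((p ^ (2 * k) : ℤ) : ℂ) := by
      rw [eq_div_iff (by push_cast; positivity)]
      push_cast; exact hN'
    have h2 := hUint k
    rw [h1] at h2
    obtain ⟨t, ht⟩ := aux_rat_int _ _ h2
    exact ⟨t, h1.trans ht⟩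
  let X : Finset (Fin n) := Finset.univ.filter fun i => ∃ c, ρ i z = Matrix.scalar (Fin (d i)) c
  have hXD : ∀ i ∈ X, ∀ g ∈ D, ρ i g = 1 := by
    intro i hi g hg
    simp only [X, Finset.mem_filter, Finset.mem_univ, true_and] at hi
    obtain ⟨c, hc⟩ := hi
    have hconj : ∀ a, IsConj z a → ρ i a = ρ i z := by
      intro a ha
      obtain ⟨g, rfl⟩ := isConj_iff.mp ha
      rw [map_mul, map_mul, hc, ← (Matrix.scalar_commute c (fun r' => mul_comm _ _) (ρ i g)).eq,
        mul_assoc, ← map_mul, mul_inv_cancel, map_one, mul_one]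
    have hle : Subgroup.closure {g | ∃ a b, IsConj z a ∧ IsConj z b ∧ g = a * b⁻¹} ≤
        (ρ i).ker := by
      rw [Subgroup.closure_le]
      rintro _ ⟨a, b, ha, hb, rfl⟩
      show ρ i (a * b⁻¹) = 1
      rw [map_mul, hconj a ha, ← hconj b hb, ← map_mul, mul_inv_cancel, map_one]
    exact hle (hD hg)
  have hlim : Filter.Tendsto U Filter.atTop (nhds (∑ i, if i ∈ X then (d i : ℂ) * d i else 0)) := by
    refine tendsto_finsetSum _ fun i _ => ?_
    split_ifs with hi
    · have h1 : (ρ i y).trace = d i := by rw [hXD i hi y hyD]; simp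
      have h2 : α i * α' i = 1 := by
        simp only [X, Finset.mem_filter, Finset.mem_univ, true_and] at hi
        obtain ⟨c, hc⟩ := hi
        have hNe : Nonempty (Fin (d i)) := ⟨⟨0, hd i⟩⟩
        have hc0 : c ≠ 0 := by
          rintro rfl
          have h3 := hpow i z
          rw [hc, map_zero, zero_pow hN.ne'] at h3
          exact zero_ne_one h3
        have hc' : ρ i z⁻¹ = Matrix.scalar (Fin (d i)) c⁻¹ := by
          refine (left_inv_eq_right_inv (a := ρ i z) ?_ ?_)
          · rw [← map_mul, inv_mul_cancel, map_one]
          · rw [hc, ← map_mul, mul_inv_cancel₀ hc0, map_one]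
        have htr : ∀ c : ℂ, (Matrix.scalar (Fin (d i)) c).trace = d i * c := by
          intro c; simp [Matrix.trace]
        simp only [α, α', hc, hc', htr]
        have := hd0 i
        field_simp
      simp only [h2, one_pow, mul_one, h1]
      exact tendsto_const_nhds
    · have hdR : (0 : ℝ) < d i := by exact_mod_cast hd i
      have h1 : ‖α i‖ < 1 := by
        simp only [α, norm_div, Complex.norm_natCast]
        rw [div_lt_one hdR]
        by_contra hcon
        push Not at hcon
        apply hi
        simp only [X, Finset.mem_filter, Finset.mem_univ, true_and]
        exact aux_trace_eq (hd i) hN _ (hpow i z) hcon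
      have h2 : ‖α' i‖ ≤ 1 := by
        simp only [α', norm_div, Complex.norm_natCast]
        rw [div_le_one hdR]
        exact aux_trace_norm hN _ (hpow i z⁻¹)
      have h3 : ‖α i * α' i‖ < 1 := by
        rw [norm_mul]
        nlinarith [norm_nonneg (α i), norm_nonneg (α' i)]
      have h4 := tendsto_pow_atTop_nhds_zero_of_norm_lt_one h3
      simpa using (h4.const_mul (d i : ℂ)).mul_const (ρ i y).trace
  set ν : ℕ := ∑ i, if i ∈ X then d i * d i else 0 with hν
  have hνC : (∑ i, if i ∈ X then (d i : ℂ) * d i else 0) = ν := by rw [hν]; push_cast; rfl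
  rw [hνC] at hlim
  obtain ⟨k, hk⟩ : ∃ k, U k = ν := by
    obtain ⟨k, hk⟩ := (Metric.tendsto_atTop.mp hlim 1 one_pos)
    refine ⟨k, ?_⟩
    have h1 := hk k le_rfl
    obtain ⟨t, ht⟩ := hUZ k
    rw [ht, dist_eq_norm] at h1
    have h2 : ((t : ℂ) - (ν : ℂ)) = ((t - ν : ℤ) : ℂ) := by push_cast; rfl
    rw [h2, Complex.norm_intCast] at h1
    have h3 : |t - (ν : ℤ)| < 1 := by exact_mod_cast h1
    rw [Int.abs_lt_one_iff] at h3
    rw [ht, sub_eq_zero.mp h3]; simp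
  have hmν : m ∣ ν := by
    obtain ⟨N, hN'⟩ := hUN k
    rw [hk, hG] at hN'
    have h1 : (ν : ℤ) * (p : ℤ) ^ (2 * k) = ((p * m : ℕ) : ℤ) * N := by exact_mod_cast hN'
    have h2 : (m : ℤ) ∣ (ν : ℤ) * (p : ℤ) ^ (2 * k) := by
      rw [h1]; push_cast; exact ⟨p * N, by ring⟩
    have h3 : m ∣ ν * p ^ (2 * k) := by exact_mod_cast h2
    exact Nat.Coprime.dvd_of_dvd_mul_right
      (((Nat.Prime.coprime_iff_not_dvd hp).mpr hpm).symm.pow_right _) h3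
  have hsub : ∀ H : Subgroup G, ∃ t : Fin n → ℕ, (∀ i, (∑ g : H, ρ i g).trace = t i) ∧
      ∑ i, d i * t i = Fintype.card G := by
    intro H
    choose t ht using fun i => aux_subgroup_trace (ρ i) H
    refine ⟨t, ht, ?_⟩
    have h := aux_coeff ρ hC (∑ g : H, MonoidAlgebra.of ℤ G g)
    simp only [map_sum, MonoidAlgebra.lift_of, ht] at h
    have h1 : (∑ g : H, MonoidAlgebra.of ℤ G g).coeff 1 = 1 := by
      rw [MonoidAlgebra.coeff_sum, Finsupp.finsetSum_apply, Finset.sum_eq_single 1]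
      · simp [MonoidAlgebra.of_apply]
      · intro b _ hb
        have : (b : G) ≠ 1 := by simpa using hb
        simp [MonoidAlgebra.of_apply, this]
      · simp
    rw [h1] at h
    have h2 : (∑ i, (d i : ℂ) * t i) = (Fintype.card G : ℂ) := by simpa using h
    exact_mod_cast h2
  have hνpos : 0 < ν := by
    obtain ⟨t, ht, hsum⟩ := hsub ⊤
    have : ∃ i, t i ≠ 0 := by
      by_contra hcon
      push Not at hcon
      simp only [hcon, mul_zero, Finset.sum_const_zero] at hsum
      omega
    obtain ⟨i, hi⟩ := this
    have hiX : i ∈ X := by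
      simp only [X, Finset.mem_filter, Finset.mem_univ, true_and]
      set E := ∑ g : (⊤ : Subgroup G), ρ i g with hE
      have hl : ∀ h : G, ρ i h * E = E := by
        intro h
        rw [hE, Finset.mul_sum]
        refine Fintype.sum_equiv (Equiv.mulLeft (⟨h, trivial⟩ : (⊤ : Subgroup G))) _ _ fun g => ?_
        simp
      have hr : ∀ h : G, E * ρ i h = E := by
        intro h
        rw [hE, Finset.sum_mul]
        refine Fintype.sum_equiv (Equiv.mulRight (⟨h, trivial⟩ : (⊤ : Subgroup G))) _ _ fun g => ?_
        simp
      obtain ⟨c, hc⟩ := hS i E fun g => by rw [hl, hr]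
      have hc0 : c ≠ 0 := by
        rintro rfl
        have h3 : E.trace = t i := by rw [hE]; convert ht i
        rw [hc] at h3
        simp at h3
        exact hi (by exact_mod_cast h3.symm)
      refine ⟨1, ?_⟩
      have h4 := hl z
      rw [hc] at h4
      calc ρ i z = ρ i z * (Matrix.scalar (Fin (d i)) c * Matrix.scalar (Fin (d i)) c⁻¹) := by
            rw [← map_mul, mul_inv_cancel₀ hc0, map_one, mul_one]
        _ = _ := by rw [← mul_assoc, h4, ← map_mul, mul_inv_cancel₀ hc0]
    refine lt_of_lt_of_le (Nat.mul_pos (hd i) (hd i)) ?_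
    rw [hν]
    have := Finset.single_le_sum (f := fun i => if i ∈ X then d i * d i else 0)
      (fun i _ => Nat.zero_le _) (Finset.mem_univ i)
    simpa [hiX] using this
  have hDν : Nat.card D * ν ≤ p * m := by
    obtain ⟨t, ht, hsum⟩ := hsub D
    rw [← hG, ← hsum, hν, Finset.mul_sum]
    refine Finset.sum_le_sum fun i _ => ?_
    split_ifs with hi
    · have h1 := ht i
      rw [Finset.sum_congr rfl (fun (g : D) _ => hXD i hi g.1 g.2)] at h1
      have h2 : ((Fintype.card D * d i : ℕ) : ℂ) = t i := by
        rw [← h1, Finset.sum_const, Matrix.trace_smul]; simp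
      have h3 : Fintype.card D * d i = t i := by exact_mod_cast h2
      rw [← h3, Nat.card_eq_fintype_card]
      exact le_of_eq (by ring)
    · simp
  have hmle : m ≤ ν := Nat.le_of_dvd hνpos hmν
  have hm0 : 0 < m := by
    rcases Nat.eq_zero_or_pos m with h | h
    · exact absurd (h ▸ dvd_zero p) hpm
    · exact h
  have : Nat.card D * m ≤ p * m := (Nat.mul_le_mul_left _ hmle).trans hDν
  exact Nat.le_of_mul_le_mul_right this hm0

theorem aux_perm_trans {Q : Type*} [Fintype Q] {p : ℕ} (hp : p.Prime)
    (hcard : Fintype.card Q = p) (w : Equiv.Perm Q) (hw : orderOf w = p) (a b : Q) :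
    ∃ k : ℤ, (w ^ k) a = b := by
  classical
  have hcyc : w.IsCycle := by
    refine Equiv.Perm.isCycle_of_prime_order' (hw ▸ hp) ?_
    rw [hcard, hw]
    have := hp.pos
    omega
  have hs : w.support = Finset.univ := by
    rw [← Finset.card_eq_iff_eq_univ, ← hcyc.orderOf, hw, hcard]
  have ha : w a ≠ a := Equiv.Perm.mem_support.1 (hs ▸ Finset.mem_univ a)
  have hb : w b ≠ b := Equiv.Perm.mem_support.1 (hs ▸ Finset.mem_univ b)
  exact hcyc.exists_zpow_eq ha hb

theorem aux_perm_cen {Q : Type*} [Fintype Q] {p : ℕ} (hp : p.Prime)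
    (hcard : Fintype.card Q = p) (G : Subgroup (Equiv.Perm Q)) [Fintype G] [DecidableEq G]
    (w : G) (hw : orderOf w = p) :
    (Finset.univ.filter fun x : G => w * x * w⁻¹ = x).card = p := by
  classical
  have hw' : orderOf (w : Equiv.Perm Q) = p := by rw [Subgroup.orderOf_coe, hw]
  have hne : Nonempty Q := by
    rw [← Fintype.card_pos_iff, hcard]; exact hp.pos
  obtain ⟨a⟩ := hne
  apply le_antisymm
  · rw [← hcard, ← Finset.card_univ]
    refine Finset.card_le_card_of_injOn (fun x : G => (x : Equiv.Perm Q) a)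
      (fun _ _ => Finset.mem_univ _) ?_
    intro x hx x' hx' hxx
    simp only [Finset.coe_filter, Finset.mem_univ, true_and, Set.mem_ofPred_eq] at hx hx' hxx
    have c1 : Commute w x := mul_inv_eq_iff_eq_mul.1 hx
    have c2 : Commute w x' := mul_inv_eq_iff_eq_mul.1 hx'
    apply Subtype.ext
    ext b
    obtain ⟨k, rfl⟩ := aux_perm_trans hp hcard w hw' a b
    have d1 := congrArg (fun g : G => (g : Equiv.Perm Q) a) (c1.zpow_left k).eq
    have d2 := congrArg (fun g : G => (g : Equiv.Perm Q) a) (c2.zpow_left k).eq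
    simp only [Subgroup.coe_mul, Subgroup.coe_zpow, Equiv.Perm.mul_apply] at d1 d2
    rw [← d1, ← d2, hxx]
  · rw [← hw, ← Fintype.card_zpowers, ← Fintype.card_coe]
    refine Fintype.card_le_of_injective
      (fun x : Subgroup.zpowers w => (⟨x.1, ?_⟩ : {x // x ∈ Finset.univ.filter fun x : G => w * x * w⁻¹ = x})) ?_
    · simp only [Finset.mem_filter, Finset.mem_univ, true_and]
      obtain ⟨k, hk⟩ := x.2
      simp only at hk
      rw [← hk, mul_inv_eq_iff_eq_mul]
      exact ((Commute.refl w).zpow_right k).eq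
    · intro x x' h
      exact Subtype.ext (congrArg (fun u => u.1) h)

/-- The group generated by all left multiplications. -/
def auxL (Q : Type*) [Quandle Q] : Subgroup (Equiv.Perm Q) :=
  Subgroup.closure (Set.range (QL : Q → Equiv.Perm Q))

theorem aux_QL_mem {Q : Type*} [Quandle Q] (a : Q) : QL a ∈ auxL Q :=
  Subgroup.subset_closure ⟨a, rfl⟩

theorem aux_Dis_le (Q : Type*) [Quandle Q] : Dis Q ≤ auxL Q := by
  refine (Subgroup.closure_le _).2 ?_
  rintro g ⟨a, b, rfl⟩
  exact (auxL Q).mul_mem (aux_QL_mem a) ((auxL Q).inv_mem (aux_QL_mem b))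

theorem aux_QL_conj {Q : Type*} [Quandle Q] (g : Equiv.Perm Q) (hg : g ∈ auxL Q) (a : Q) :
    g * QL a * g⁻¹ = QL (g a) := by
  induction hg using Subgroup.closure_induction generalizing a with
  | mem x hx =>
    obtain ⟨b, rfl⟩ := hx
    exact (Rack.ad_conj b a).symm
  | one => simp
  | mul x y _ _ hx hy =>
    rw [Equiv.Perm.mul_apply, ← hx, ← hy, mul_inv_rev]
    simp only [mul_assoc]
  | inv x _ hx =>
    have h := hx (x⁻¹ a)
    rw [← Equiv.Perm.mul_apply, mul_inv_cancel, Equiv.Perm.one_apply] at h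
    rw [← h]
    simp [mul_assoc]

theorem aux_QL_inj {Q : Type*} [Quandle Q] [Fintype Q] {p : ℕ} (hp : p.Prime)
    (hcard : Fintype.card Q = p) (hconn : ∀ x y : Q, ∃ g ∈ Dis Q, g x = y)
    (y : Equiv.Perm Q) (hyG : y ∈ auxL Q) (hy : orderOf y = p) :
    Function.Injective (QL : Q → Equiv.Perm Q) := by
  intro a b hab
  by_contra hne
  obtain ⟨k, hk⟩ := aux_perm_trans hp hcard y hy a b
  have hwG : y ^ k ∈ auxL Q := (auxL Q).zpow_mem hyG k
  have hw : orderOf (y ^ k) = p := by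
    have h1 : (y ^ k) ^ p = 1 := by
      rw [← zpow_natCast, ← zpow_mul, mul_comm, zpow_mul, zpow_natCast, ← hy, pow_orderOf_eq_one,
        one_zpow]
    have := Fact.mk hp
    refine orderOf_eq_prime h1 ?_
    intro h
    rw [h] at hk
    exact hne hk
  have hc : Commute (y ^ k) (QL a) := by
    have := aux_QL_conj _ hwG a
    rw [hk, ← hab] at this
    exact mul_inv_eq_iff_eq_mul.1 this
  have hall : ∀ c, QL c = QL a := by
    intro c
    obtain ⟨j, rfl⟩ := aux_perm_trans hp hcard _ hw a c
    rw [← aux_QL_conj _ ((auxL Q).zpow_mem hwG j) a, mul_inv_eq_iff_eq_mul]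
    exact (hc.zpow_left j).eq
  obtain ⟨g, hg, hgab⟩ := hconn a b
  have hD : Dis Q ≤ ⊥ := by
    refine (Subgroup.closure_le _).2 ?_
    rintro g ⟨c, d, rfl⟩
    simp [hall c, hall d]
  have := Subgroup.mem_bot.1 (hD hg)
  rw [this] at hgab
  exact hne hgab

theorem aux_Dis_card {Q : Type*} [Quandle Q] [Fintype Q] {p : ℕ} (hp : p.Prime)
    (hcard : Fintype.card Q = p) (hconn : ∀ x y : Q, ∃ g ∈ Dis Q, g x = y) :
    Nat.card (Dis Q) ≤ p := by
  classical
  have := Fact.mk hp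
  have hne : Nonempty Q := by
    rw [← Fintype.card_pos_iff, hcard]; exact hp.pos
  obtain ⟨a₀⟩ := hne
  have hpD : p ∣ Nat.card (Dis Q) := by
    have : MulAction.IsPretransitive (Dis Q) Q :=
      ⟨fun x y => by
        obtain ⟨g, hg, h⟩ := hconn x y
        exact ⟨⟨g, hg⟩, h⟩⟩
    have h := (MulAction.stabilizer (Dis Q) a₀).index_dvd_card
    rwa [MulAction.index_stabilizer_of_transitive, Nat.card_eq_fintype_card, hcard] at h
  obtain ⟨y, hy⟩ := exists_prime_orderOf_dvd_card' p hpD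
  have hy' : orderOf (y : Equiv.Perm Q) = p := by rw [Subgroup.orderOf_coe, hy]
  have hyG : (y : Equiv.Perm Q) ∈ auxL Q := aux_Dis_le Q y.2
  have hinj := aux_QL_inj hp hcard hconn y hyG hy'
  have hpG : p ∣ Nat.card (auxL Q) := hpD.trans (Subgroup.card_dvd_of_le (aux_Dis_le Q))
  obtain ⟨m, hm⟩ := hpG
  have hpm : ¬ p ∣ m := by
    rintro ⟨l, rfl⟩
    have h1 : Nat.card (auxL Q) ∣ Nat.card (Equiv.Perm Q) := Subgroup.card_subgroup_dvd_card _
    rw [hm, Nat.card_eq_fintype_card, Fintype.card_perm, hcard] at h1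
    obtain ⟨q, rfl⟩ : ∃ q, p = q + 1 := ⟨p - 1, by have := hp.pos; omega⟩
    rw [Nat.factorial_succ] at h1
    have h2 := Nat.dvd_of_mul_dvd_mul_left (Nat.succ_pos q) h1
    have h3 := (hp.dvd_factorial).1 ((dvd_mul_right _ _).trans h2)
    omega
  let z : auxL Q := ⟨QL a₀, aux_QL_mem a₀⟩
  have hzc : ∀ a : Q, IsConj z ⟨QL a, aux_QL_mem a⟩ := by
    intro a
    obtain ⟨g, hg, rfl⟩ := hconn a₀ a
    rw [isConj_iff]
    refine ⟨⟨g, aux_Dis_le Q hg⟩, Subtype.ext ?_⟩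
    exact aux_QL_conj g (aux_Dis_le Q hg) a₀
  have hz : (Finset.univ.filter fun c : auxL Q => IsConj z c).card = p := by
    rw [← hcard, ← Finset.card_univ]
    symm
    refine Finset.card_bij (fun a _ => (⟨QL a, aux_QL_mem a⟩ : auxL Q)) ?_ ?_ ?_
    · intro a _
      simpa using hzc a
    · intro a _ b _ h
      exact hinj (congrArg Subtype.val h)
    · intro c hc
      simp only [Finset.mem_filter, Finset.mem_univ, true_and] at hc
      obtain ⟨g, rfl⟩ := isConj_iff.1 hc
      exact ⟨(g : Equiv.Perm Q) a₀, Finset.mem_univ _,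
        Subtype.ext (aux_QL_conj g g.2 a₀).symm⟩
  have key := aux_main (G := auxL Q) hp (by rw [← hm, Nat.card_eq_fintype_card]) hpm
    (fun w hw => aux_perm_cen hp hcard (auxL Q) w hw) ⟨y, hyG⟩ z
    (by rw [← Subgroup.orderOf_coe]; exact hy') hz ((Dis Q).subgroupOf (auxL Q))
    (Subgroup.mem_subgroupOf.2 y.2) ?_
  · rwa [Nat.card_congr (Subgroup.subgroupOfEquivOfLe (aux_Dis_le Q)).toEquiv] at key
  · intro x hx
    rw [Subgroup.mem_subgroupOf] at hx
    have hle : Dis Q ≤ (Subgroup.closure {g : auxL Q | ∃ a b, IsConj z a ∧ IsConj z b ∧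
        g = a * b⁻¹}).map (auxL Q).subtype := by
      refine (Subgroup.closure_le _).2 ?_
      rintro g ⟨a, b, rfl⟩
      exact ⟨_, Subgroup.subset_closure ⟨_, _, hzc a, hzc b, rfl⟩, rfl⟩
    obtain ⟨x', hx', h⟩ := hle hx
    have : x' = x := Subtype.ext h
    exact this ▸ hx'

theorem aux_Dis_conj {Q : Type*} [Quandle Q] (g : Equiv.Perm Q) (hg : g ∈ auxL Q)
    (x : Equiv.Perm Q) (hx : x ∈ Dis Q) : g * x * g⁻¹ ∈ Dis Q := by
  induction hx using Subgroup.closure_induction with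
  | mem x hx =>
    obtain ⟨a, b, rfl⟩ := hx
    refine Subgroup.subset_closure ⟨g a, g b, ?_⟩
    rw [← aux_QL_conj g hg, ← aux_QL_conj g hg]
    group
  | one => simp
  | mul x y _ _ hx hy =>
    have := (Dis Q).mul_mem hx hy
    simpa [mul_assoc] using this
  | inv x _ hx =>
    have := (Dis Q).inv_mem hx
    simpa [mul_assoc] using this

theorem stmt12 (p : ℕ) (hp : p.Prime) (Q : Type u) [Quandle Q]
    (hconn : ∀ x y : Q, ∃ g ∈ Dis Q, g x = y)
    (hcard : Nat.card Q = p) :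
    IsAffine Q := by
  classical
  have : Finite Q := Nat.finite_of_card_ne_zero (hcard ▸ hp.ne_zero)
  have : Fintype Q := Fintype.ofFinite Q
  have := Fact.mk hp
  have hcard' : Fintype.card Q = p := by rw [← Nat.card_eq_fintype_card, hcard]
  have hne : Nonempty Q := by
    rw [← Fintype.card_pos_iff, hcard']; exact hp.pos
  obtain ⟨o⟩ := hne
  have hsurj : Function.Surjective (fun g : Dis Q => (g : Equiv.Perm Q) o) := by
    intro x
    obtain ⟨g, hg, h⟩ := hconn o x
    exact ⟨⟨g, hg⟩, h⟩
  have hle := aux_Dis_card hp hcard' hconn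
  have hDp : Nat.card (Dis Q) = p :=
    le_antisymm hle (hcard ▸ Nat.card_le_card_of_surjective _ hsurj)
  have hbij : Function.Bijective (fun g : Dis Q => (g : Equiv.Perm Q) o) :=
    (Nat.bijective_iff_surjective_and_card _).2 ⟨hsurj, by rw [hDp, hcard]⟩
  have : IsCyclic (Dis Q) := isCyclic_of_prime_card hDp
  let : CommGroup (Dis Q) := IsCyclic.commGroup
  let c : Dis Q ≃* Dis Q :=
    { toFun := fun g => ⟨QL o * g * (QL o)⁻¹, aux_Dis_conj _ (aux_QL_mem o) _ g.2⟩
      invFun := fun g => ⟨(QL o)⁻¹ * g * ((QL o)⁻¹)⁻¹,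
        aux_Dis_conj _ ((auxL Q).inv_mem (aux_QL_mem o)) _ g.2⟩
      left_inv := fun g => Subtype.ext (by simp [mul_assoc])
      right_inv := fun g => Subtype.ext (by simp [mul_assoc])
      map_mul' := fun g h => Subtype.ext (by
        change QL o * ((g : Equiv.Perm Q) * h) * (QL o)⁻¹ =
          (QL o * g * (QL o)⁻¹) * (QL o * h * (QL o)⁻¹)
        group) }
  let e : Dis Q ≃ Q := Equiv.ofBijective _ hbij
  have he : ∀ g : Dis Q, e g = (g : Equiv.Perm Q) o := fun g => rfl
  have hoo : QL o o = o := Quandle.fix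
  have hoo' : (QL o)⁻¹ o = o := by rw [Equiv.Perm.inv_eq_iff_eq, hoo]
  refine ⟨Additive (Dis Q), inferInstance, MulEquiv.toAdditive c,
    e.symm.trans Additive.ofMul, ?_⟩
  intro x y
  obtain ⟨g, rfl⟩ := e.surjective x
  obtain ⟨h, rfl⟩ := e.surjective y
  have hmain : e g ◃ e h = e (g * (c g)⁻¹ * c h) := by
    have h1 : e g ◃ e h = (QL (e g)) (e h) := rfl
    rw [h1, he g, ← aux_QL_conj g (aux_Dis_le Q g.2) o, he h, he]
    have h2 : g * (c g)⁻¹ * c h = g * c (g⁻¹ * h) := by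
      rw [map_mul, map_inv, mul_assoc]
    rw [h2]
    change _ = ((g : Equiv.Perm Q) * (QL o * ((g : Equiv.Perm Q)⁻¹ * h) * (QL o)⁻¹)) o
    simp only [Equiv.Perm.mul_apply, hoo']
  rw [hmain]
  simp only [Equiv.trans_apply, Equiv.symm_apply_apply]
  change Additive.ofMul (g * (c g)⁻¹ * c h) =
    Additive.ofMul g - Additive.ofMul (c g) + Additive.ofMul (c h)
  rw [ofMul_mul, ofMul_mul, ofMul_inv, sub_eq_add_neg]
end
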